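/- Let Ω be a bounded domain in ℝ^m with infinitely smooth boundary. Let B be a non-negative injective compact operator on L²(Ω) such that for every f ∈ L²(Ω) the function u = Bf satisfies -Δu = f in the distributional sense, with lim_{n→∞} n^2 s_n(B) = ∞ and lim_{n→∞} n^α s_n(B) = a for some 0 < α < 2 and 0 < a < ∞, and let K be a bounded operator on L²(Ω) in the Schatten class S_q for some 0 < q ≤ 1/α with range contained in {u ∈ L²(Ω) : Δu = 0 distributionally}. Then the adjoint operator (B + K)* = B + K* has a nonzero eigenvalue; hence the adjoint L_K* of the corresponding well-defined restriction L_K is not Volterra. -/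

import Mathlib

open Filter Topology MeasureTheory

/-- The `n`-th singular value (`s`-number) of an operator on a Hilbert space,
indexed so that `sNum T 1 = ‖T‖`: `sNum T n` is the distance from `T` to the
operators of rank `< n`. -/
noncomputable def sNum {H : Type*} [NormedAddCommGroup H] [InnerProductSpace ℂ H]
    (T : H →L[ℂ] H) (n : ℕ) : ℝ :=
  ⨅ F : {F : H →L[ℂ] H // Module.rank ℂ (LinearMap.range (F : H →ₗ[ℂ] H)) < (n : Cardinal)},
    ‖T - (F : H →L[ℂ] H)‖

/-- The Laplacian of a test function on `ℝ^m`, as the sum of the second partial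
derivatives in the coordinate directions. -/
noncomputable def testLaplacian {m : ℕ} (φ : EuclideanSpace ℝ (Fin m) → ℂ)
    (x : EuclideanSpace ℝ (Fin m)) : ℂ :=
  ∑ i : Fin m,
    iteratedFDeriv ℝ 2 φ x ![EuclideanSpace.single i 1, EuclideanSpace.single i 1]

/-- `u` is harmonic on `Ω` in the distributional sense: `∫ u Δφ = 0` for every smooth
compactly supported test function `φ` with support in `Ω`. -/
def WeakHarmonicOn {m : ℕ} (Ω : Set (EuclideanSpace ℝ (Fin m)))
    (u : EuclideanSpace ℝ (Fin m) → ℂ) : Prop :=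
  ∀ φ : EuclideanSpace ℝ (Fin m) → ℂ, ContDiff ℝ (⊤ : ℕ∞) φ → HasCompactSupport φ →
    tsupport φ ⊆ Ω → ∫ x in Ω, u x * testLaplacian φ x = 0

/-- `-Δu = f` on `Ω` in the distributional sense: `∫ u Δφ = -∫ f φ` for every smooth
compactly supported test function `φ` with support in `Ω`. -/
def WeakNegLapEq {m : ℕ} (Ω : Set (EuclideanSpace ℝ (Fin m)))
    (u f : EuclideanSpace ℝ (Fin m) → ℂ) : Prop :=
  ∀ φ : EuclideanSpace ℝ (Fin m) → ℂ, ContDiff ℝ (⊤ : ℕ∞) φ → HasCompactSupport φ →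
    tsupport φ ⊆ Ω → ∫ x in Ω, u x * testLaplacian φ x = -∫ x in Ω, f x * φ x

/-- `Ω` has infinitely smooth boundary: every boundary point admits a local smooth
defining function with nonvanishing derivative. -/
def HasSmoothBoundary {m : ℕ} (Ω : Set (EuclideanSpace ℝ (Fin m))) : Prop :=
  ∀ x ∈ frontier Ω, ∃ (U : Set (EuclideanSpace ℝ (Fin m)))
    (ψ : EuclideanSpace ℝ (Fin m) → ℝ), IsOpen U ∧ x ∈ U ∧ ContDiff ℝ (⊤ : ℕ∞) ψ ∧
      (∀ y ∈ U, fderiv ℝ ψ y ≠ 0) ∧ Ω ∩ U = {y ∈ U | ψ y < 0}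



open Filter Topology MeasureTheory

section SNumBasics
universe u
variable {H E : Type u} [NormedAddCommGroup H] [InnerProductSpace ℂ H]
  [NormedAddCommGroup E] [InnerProductSpace ℂ E]

lemma sNum_nonneg (T : H →L[ℂ] H) (n : ℕ) : 0 ≤ sNum T n :=
  Real.iInf_nonneg fun _ => norm_nonneg _

lemma sNum_le_of_rank {T F : H →L[ℂ] H} {n : ℕ}
    (hF : Module.rank ℂ (LinearMap.range (F : H →ₗ[ℂ] H)) < (n : Cardinal)) :
    sNum T n ≤ ‖T - F‖ := by
  have hb : BddBelow (Set.range fun F : {F : H →L[ℂ] H //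
      Module.rank ℂ (LinearMap.range (F : H →ₗ[ℂ] H)) < (n : Cardinal)} => ‖T - (F : H →L[ℂ] H)‖) :=
    ⟨0, by rintro _ ⟨F, rfl⟩; exact norm_nonneg _⟩
  exact ciInf_le hb ⟨F, hF⟩

lemma rank_zero_lt {n : ℕ} (hn : 1 ≤ n) :
    Module.rank ℂ (LinearMap.range ((0 : H →L[ℂ] H) : H →ₗ[ℂ] H)) < (n : Cardinal) := by
  have : LinearMap.range ((0 : H →L[ℂ] H) : H →ₗ[ℂ] H) = ⊥ := by
    simp
  rw [this, rank_bot]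
  exact_mod_cast hn

lemma exists_of_sNum_lt {T : H →L[ℂ] H} {n : ℕ} (hn : 1 ≤ n) {c : ℝ} (h : sNum T n < c) :
    ∃ F : H →L[ℂ] H, Module.rank ℂ (LinearMap.range (F : H →ₗ[ℂ] H)) < (n : Cardinal) ∧
      ‖T - F‖ < c := by
  have : Nonempty {F : H →L[ℂ] H //
      Module.rank ℂ (LinearMap.range (F : H →ₗ[ℂ] H)) < (n : Cardinal)} := ⟨⟨0, rank_zero_lt hn⟩⟩
  obtain ⟨F, hF⟩ := exists_lt_of_ciInf_lt h
  exact ⟨F.1, F.2, hF⟩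

lemma le_sNum {T : H →L[ℂ] H} {n : ℕ} (hn : 1 ≤ n) {c : ℝ}
    (h : ∀ F : H →L[ℂ] H, Module.rank ℂ (LinearMap.range (F : H →ₗ[ℂ] H)) < (n : Cardinal) →
      c ≤ ‖T - F‖) : c ≤ sNum T n := by
  by_contra! hc
  obtain ⟨F, hF, h2⟩ := exists_of_sNum_lt hn hc
  exact absurd (h F hF) (not_le.2 h2)

lemma sNum_anti (T : H →L[ℂ] H) {m n : ℕ} (hm : 1 ≤ m) (hmn : m ≤ n) : sNum T n ≤ sNum T m :=
  le_sNum hm fun F hF => sNum_le_of_rank (hF.trans_le (by exact_mod_cast hmn))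

lemma sNum_le_norm (T : H →L[ℂ] H) {n : ℕ} (hn : 1 ≤ n) : sNum T n ≤ ‖T‖ := by
  simpa using sNum_le_of_rank (T := T) (rank_zero_lt hn)

lemma sNum_zero_idx (T : H →L[ℂ] H) : sNum T 0 = 0 := by
  unfold sNum
  have : IsEmpty {F : H →L[ℂ] H //
      Module.rank ℂ (LinearMap.range (F : H →ₗ[ℂ] H)) < ((0 : ℕ) : Cardinal)} :=
    ⟨fun F => by simpa using F.2⟩
  exact Real.iInf_of_isEmpty _

lemma sNum_comp_le (T : H →L[ℂ] H) (X : H →L[ℂ] E) (Y : E →L[ℂ] H) (n : ℕ) :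
    sNum (X ∘L T ∘L Y) n ≤ ‖X‖ * ‖Y‖ * sNum T n := by
  rcases Nat.eq_zero_or_pos n with rfl | hn
  · simp [sNum_zero_idx]
  refine le_of_forall_pos_le_add fun ε hε => ?_
  obtain ⟨F, hF, hF2⟩ := exists_of_sNum_lt (T := T) hn
    (show sNum T n < sNum T n + ε / (‖X‖ * ‖Y‖ + 1) by
      have : 0 < ε / (‖X‖ * ‖Y‖ + 1) := by positivity
      linarith)
  have hr : Module.rank ℂ (LinearMap.range ((X ∘L F ∘L Y : E →L[ℂ] E) : E →ₗ[ℂ] E)) < n := by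
    refine lt_of_le_of_lt ?_ hF
    have h1 := LinearMap.rank_comp_le_right ((F ∘L Y : E →L[ℂ] H) : E →ₗ[ℂ] H) (X : H →ₗ[ℂ] E)
    have h2 := LinearMap.rank_comp_le_left (Y : E →ₗ[ℂ] H) (F : H →ₗ[ℂ] H)
    exact h1.trans h2
  refine (sNum_le_of_rank hr).trans ?_
  have e : X ∘L T ∘L Y - X ∘L F ∘L Y = X ∘L (T - F) ∘L Y := by
    ext v; simp
  rw [e]
  have h1 : ‖X ∘L (T - F) ∘L Y‖ ≤ ‖X‖ * (‖T - F‖ * ‖Y‖) :=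
    (ContinuousLinearMap.opNorm_comp_le _ _).trans
      (mul_le_mul_of_nonneg_left (ContinuousLinearMap.opNorm_comp_le _ _) (norm_nonneg _))
  refine h1.trans ?_
  have hp : 0 ≤ ‖X‖ * ‖Y‖ := by positivity
  calc ‖X‖ * (‖T - F‖ * ‖Y‖) = ‖X‖ * ‖Y‖ * ‖T - F‖ := by ring
    _ ≤ ‖X‖ * ‖Y‖ * (sNum T n + ε / (‖X‖ * ‖Y‖ + 1)) := by gcongr
    _ = ‖X‖ * ‖Y‖ * sNum T n + ε * ((‖X‖ * ‖Y‖) / (‖X‖ * ‖Y‖ + 1)) := by ring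
    _ ≤ ‖X‖ * ‖Y‖ * sNum T n + ε * 1 := by
        gcongr
        rw [div_le_one (by positivity)]; linarith
    _ = _ := by ring

lemma sNum_comp_le_of_le_one (T : H →L[ℂ] H) (X : H →L[ℂ] E) (Y : E →L[ℂ] H)
    (hX : ‖X‖ ≤ 1) (hY : ‖Y‖ ≤ 1) (n : ℕ) :
    sNum (X ∘L T ∘L Y) n ≤ sNum T n := by
  refine (sNum_comp_le T X Y n).trans ?_
  have := sNum_nonneg T n
  have h : ‖X‖ * ‖Y‖ ≤ 1 := mul_le_one₀ hX (norm_nonneg _) hY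
  nlinarith

lemma sNum_mul_left_le (S T : H →L[ℂ] H) (n : ℕ) : sNum (S * T) n ≤ ‖S‖ * sNum T n := by
  have h := sNum_comp_le T S (ContinuousLinearMap.id ℂ H) n
  refine h.trans ?_
  have h1 := ContinuousLinearMap.norm_id_le (𝕜 := ℂ) (E := H)
  have := sNum_nonneg T n
  gcongr
  nlinarith [norm_nonneg S]

lemma sNum_le_add_norm (S T : H →L[ℂ] H) (n : ℕ) : sNum S n ≤ sNum T n + ‖S - T‖ := by
  rcases Nat.eq_zero_or_pos n with rfl | hn
  · simp [sNum_zero_idx]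
  rw [← sub_le_iff_le_add]
  refine le_sNum hn fun F hF => ?_
  have h1 := sNum_le_of_rank (T := S) hF
  have h2 : ‖S - F‖ ≤ ‖S - T‖ + ‖T - F‖ := norm_sub_le_norm_sub_add_norm_sub _ _ _
  linarith

lemma rank_add_lt {F G : H →L[ℂ] H} {m n : ℕ}
    (hF : Module.rank ℂ (LinearMap.range (F : H →ₗ[ℂ] H)) < ((m + 1 : ℕ) : Cardinal))
    (hG : Module.rank ℂ (LinearMap.range (G : H →ₗ[ℂ] H)) < ((n + 1 : ℕ) : Cardinal)) :
    Module.rank ℂ (LinearMap.range ((F + G : H →L[ℂ] H) : H →ₗ[ℂ] H))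
      < ((m + n + 1 : ℕ) : Cardinal) := by
  have h := LinearMap.rank_add_le (F : H →ₗ[ℂ] H) (G : H →ₗ[ℂ] H)
  unfold LinearMap.rank at h
  obtain ⟨a, ha⟩ := Cardinal.lt_aleph0.1 (hF.trans Cardinal.natCast_lt_aleph0)
  obtain ⟨b, hb⟩ := Cardinal.lt_aleph0.1 (hG.trans Cardinal.natCast_lt_aleph0)
  rw [ha] at hF h
  rw [hb] at hG h
  refine lt_of_le_of_lt h ?_
  norm_cast at *
  omega

lemma sNum_add_le (S T : H →L[ℂ] H) (m n : ℕ) :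
    sNum (S + T) (m + n + 1) ≤ sNum S (m + 1) + sNum T (n + 1) := by
  refine le_of_forall_pos_le_add fun ε hε => ?_
  obtain ⟨F, hF, hF2⟩ := exists_of_sNum_lt (T := S) (n := m + 1) (by omega)
    (show sNum S (m + 1) < sNum S (m + 1) + ε / 2 by linarith)
  obtain ⟨G, hG, hG2⟩ := exists_of_sNum_lt (T := T) (n := n + 1) (by omega)
    (show sNum T (n + 1) < sNum T (n + 1) + ε / 2 by linarith)
  refine (sNum_le_of_rank (rank_add_lt hF hG)).trans ?_
  have : S + T - (F + G) = (S - F) + (T - G) := by abel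
  rw [this]
  have := norm_add_le (S - F) (T - G)
  linarith

lemma sNum_mul_le (S T : H →L[ℂ] H) (m n : ℕ) :
    sNum (S * T) (m + n + 1) ≤ sNum S (m + 1) * sNum T (n + 1) := by
  have key : ∀ ε > 0, sNum (S * T) (m + n + 1) ≤ (sNum S (m + 1) + ε) * (sNum T (n + 1) + ε) := by
    intro ε hε
    obtain ⟨F, hF, hF2⟩ := exists_of_sNum_lt (T := S) (n := m + 1) (by omega)
      (show sNum S (m + 1) < sNum S (m + 1) + ε by linarith)
    obtain ⟨G, hG, hG2⟩ := exists_of_sNum_lt (T := T) (n := n + 1) (by omega)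
      (show sNum T (n + 1) < sNum T (n + 1) + ε by linarith)
    have h1 : Module.rank ℂ (LinearMap.range ((F * T : H →L[ℂ] H) : H →ₗ[ℂ] H))
        < ((m + 1 : ℕ) : Cardinal) :=
      lt_of_le_of_lt (LinearMap.rank_comp_le_left (T : H →ₗ[ℂ] H) (F : H →ₗ[ℂ] H)) hF
    have h2 : Module.rank ℂ (LinearMap.range (((S - F) * G : H →L[ℂ] H) : H →ₗ[ℂ] H))
        < ((n + 1 : ℕ) : Cardinal) :=
      lt_of_le_of_lt
        (LinearMap.rank_comp_le_right (G : H →ₗ[ℂ] H) ((S - F : H →L[ℂ] H) : H →ₗ[ℂ] H)) hG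
    refine (sNum_le_of_rank (rank_add_lt h1 h2)).trans ?_
    have : S * T - (F * T + (S - F) * G) = (S - F) * (T - G) := by noncomm_ring
    rw [this]
    refine (norm_mul_le _ _).trans ?_
    have := sNum_nonneg S (m + 1)
    gcongr
  have hlim : Tendsto (fun ε : ℝ => (sNum S (m + 1) + ε) * (sNum T (n + 1) + ε)) (𝓝[>] 0)
      (𝓝 (sNum S (m + 1) * sNum T (n + 1))) := by
    have : ContinuousAt (fun ε : ℝ => (sNum S (m + 1) + ε) * (sNum T (n + 1) + ε)) 0 := by fun_prop
    have h := this.tendsto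
    simp only [add_zero] at h
    exact h.mono_left nhdsWithin_le_nhds
  exact ge_of_tendsto hlim (by filter_upwards [self_mem_nhdsWithin] with ε hε using key ε hε)

lemma finiteDimensional_range_of_rank_lt {F : H →L[ℂ] H} {n : ℕ}
    (hF : Module.rank ℂ (LinearMap.range (F : H →ₗ[ℂ] H)) < (n : Cardinal)) :
    FiniteDimensional ℂ (LinearMap.range (F : H →ₗ[ℂ] H)) :=
  Module.rank_lt_aleph0_iff.1 (hF.trans Cardinal.natCast_lt_aleph0)

lemma rank_adjoint_lt [CompleteSpace H] {F : H →L[ℂ] H} {n : ℕ}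
    (hF : Module.rank ℂ (LinearMap.range (F : H →ₗ[ℂ] H)) < (n : Cardinal)) :
    Module.rank ℂ (LinearMap.range ((ContinuousLinearMap.adjoint F : H →L[ℂ] H) : H →ₗ[ℂ] H))
      < (n : Cardinal) := by
  have := finiteDimensional_range_of_rank_lt hF
  set W := LinearMap.range (F : H →ₗ[ℂ] H) with hW
  have h1 : W.starProjection ∘L F = F := by
    ext v
    simp only [ContinuousLinearMap.comp_apply]
    exact Submodule.starProjection_eq_self_iff.2 ⟨v, rfl⟩
  have h2 : ContinuousLinearMap.adjoint F = ContinuousLinearMap.adjoint F ∘L W.starProjection := by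
    conv_lhs => rw [← h1]
    rw [ContinuousLinearMap.adjoint_comp]
    congr 1
    exact (isSelfAdjoint_starProjection W)
  rw [h2]
  refine lt_of_le_of_lt (LinearMap.rank_comp_le_right (W.starProjection : H →ₗ[ℂ] H)
    ((ContinuousLinearMap.adjoint F : H →L[ℂ] H) : H →ₗ[ℂ] H)) ?_
  refine lt_of_le_of_lt ?_ hF
  unfold LinearMap.rank
  refine Submodule.rank_mono ?_
  rintro _ ⟨v, rfl⟩
  exact Submodule.starProjection_apply_mem _ _

lemma sNum_adjoint_le [CompleteSpace H] (T : H →L[ℂ] H) (n : ℕ) :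
    sNum (ContinuousLinearMap.adjoint T) n ≤ sNum T n := by
  rcases Nat.eq_zero_or_pos n with rfl | hn
  · simp [sNum_zero_idx]
  refine le_sNum hn fun F hF => (sNum_le_of_rank (rank_adjoint_lt hF)).trans ?_
  rw [← map_sub]
  exact (LinearIsometryEquiv.norm_map _ _).le

end SNumBasics

open Filter Topology MeasureTheory

section FinDim
universe u
variable {E : Type u} [NormedAddCommGroup E] [InnerProductSpace ℂ E]

lemma le_sNum_of_subspace {T : E →L[ℂ] E} {n : ℕ} (hn : 1 ≤ n) {c : ℝ} (W : Submodule ℂ E)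
    [FiniteDimensional ℂ W] (hW : n ≤ Module.finrank ℂ W) (h : ∀ v ∈ W, c * ‖v‖ ≤ ‖T v‖) :
    c ≤ sNum T n := by
  refine le_sNum hn fun F hF => ?_
  have := finiteDimensional_range_of_rank_lt hF
  have h1 : Module.finrank ℂ (LinearMap.range (F : E →ₗ[ℂ] E)) < n := by
    rw [← Module.finrank_eq_rank] at hF
    exact_mod_cast hF
  let G : W →ₗ[ℂ] LinearMap.range (F : E →ₗ[ℂ] E) := (F : E →ₗ[ℂ] E).rangeRestrict ∘ₗ W.subtype
  have hk : LinearMap.ker G ≠ ⊥ := LinearMap.ker_ne_bot_of_finrank_lt (by omega)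
  obtain ⟨w, hw, hw0⟩ := Submodule.exists_mem_ne_zero_of_ne_bot hk
  have hF0 : F (w : E) = 0 := by
    have := congrArg Subtype.val (LinearMap.mem_ker.1 hw)
    simpa [G] using this
  have h2 := h w w.2
  have h3 : ‖T (w : E)‖ ≤ ‖T - F‖ * ‖(w : E)‖ := by
    have := (T - F).le_opNorm (w : E)
    simpa [hF0] using this
  have h4 : 0 < ‖(w : E)‖ := by simpa using hw0
  exact le_of_mul_le_mul_right (h2.trans h3) h4

variable [FiniteDimensional ℂ E] {N : ℕ}

/-- diagonal operator in an orthonormal basis -/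
noncomputable def diagOp (b : OrthonormalBasis (Fin N) ℂ E) (d : Fin N → ℂ) : E →L[ℂ] E :=
  LinearMap.toContinuousLinearMap (b.toBasis.constr ℂ (fun k => d k • b k))

lemma diagOp_basis (b : OrthonormalBasis (Fin N) ℂ E) (d : Fin N → ℂ) (k : Fin N) :
    diagOp b d (b k) = d k • b k := by
  have := b.toBasis.constr_basis ℂ (fun k => d k • b k) k
  simpa [diagOp] using this

lemma clm_ext_basis (b : OrthonormalBasis (Fin N) ℂ E) {S T : E →L[ℂ] E}
    (h : ∀ k, S (b k) = T (b k)) : S = T := by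
  have : (S : E →ₗ[ℂ] E) = T := b.toBasis.ext (by simpa using h)
  exact_mod_cast this

lemma diagOp_one (b : OrthonormalBasis (Fin N) ℂ E) : diagOp b (fun _ => 1) = 1 :=
  clm_ext_basis b fun k => by simp [diagOp_basis]

lemma diagOp_mul (b : OrthonormalBasis (Fin N) ℂ E) (d d' : Fin N → ℂ) :
    diagOp b d * diagOp b d' = diagOp b (fun k => d k * d' k) :=
  clm_ext_basis b fun k => by simp [diagOp_basis, smul_smul, mul_comm]

lemma inner_diagOp (b : OrthonormalBasis (Fin N) ℂ E) (d : Fin N → ℂ) (v : E) (k : Fin N) :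
    inner ℂ (b k) (diagOp b d v) = d k * inner ℂ (b k) v := by
  conv_lhs => rw [← b.sum_repr' v]
  simp only [map_sum, map_smul, diagOp_basis, inner_sum, inner_smul_right]
  rw [Finset.sum_eq_single k]
  · simp [mul_comm]
  · intro j _ hj
    simp [b.orthonormal.2 hj.symm]
  · simp

lemma norm_diagOp_sq (b : OrthonormalBasis (Fin N) ℂ E) (d : Fin N → ℂ) (v : E) :
    ‖diagOp b d v‖ ^ 2 = ∑ k, (‖d k‖ * ‖inner ℂ (b k) v‖) ^ 2 := by
  rw [← b.sum_sq_norm_inner_right]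
  simp [inner_diagOp]

lemma norm_diagOp_le (b : OrthonormalBasis (Fin N) ℂ E) (d : Fin N → ℂ) {C : ℝ} (hC : 0 ≤ C)
    (h : ∀ k, ‖d k‖ ≤ C) : ‖diagOp b d‖ ≤ C := by
  refine ContinuousLinearMap.opNorm_le_bound _ hC fun v => ?_
  refine le_of_sq_le_sq ?_ (by positivity)
  rw [norm_diagOp_sq, mul_pow, ← b.sum_sq_norm_inner_right v, Finset.mul_sum]
  refine Finset.sum_le_sum fun k _ => ?_
  rw [mul_pow]
  gcongr
  exact h k

lemma det_diagOp (b : OrthonormalBasis (Fin N) ℂ E) (d : Fin N → ℂ) :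
    LinearMap.det (diagOp b d : E →ₗ[ℂ] E) = ∏ k, d k := by
  rw [← LinearMap.det_toMatrix b.toBasis]
  have : LinearMap.toMatrix b.toBasis b.toBasis (diagOp b d : E →ₗ[ℂ] E) = Matrix.diagonal d := by
    ext i j
    rw [LinearMap.toMatrix_apply]
    simp [diagOp_basis, Matrix.diagonal_apply]
    by_cases h : i = j
    · subst h; simp
    · simp [h]
  rw [this, Matrix.det_diagonal]

lemma sNum_ge_of_diag (b : OrthonormalBasis (Fin N) ℂ E) (w : Fin N → ℝ) (hw : Antitone w)
    (hw0 : ∀ k, 0 ≤ w k) {T : E →L[ℂ] E}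
    (hT : ∀ v, ‖T v‖ ^ 2 = ∑ k, (w k * ‖inner ℂ (b k) v‖) ^ 2) (i : Fin N) :
    w i ≤ sNum T (i + 1) := by
  let f : Fin (i + 1) → E := fun k => b (Fin.castLE (by omega) k)
  have hf : LinearIndependent ℂ f :=
    b.orthonormal.linearIndependent.comp _ (Fin.castLE_injective _)
  refine le_sNum_of_subspace (by omega) (Submodule.span ℂ (Set.range f))
    (by rw [finrank_span_eq_card hf]; simp) fun v hv => ?_
  have hz : ∀ k : Fin N, i < k → inner ℂ (b k) v = 0 := by
    intro k hk
    induction hv using Submodule.span_induction with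
    | mem x hx =>
      obtain ⟨j, rfl⟩ := hx
      refine b.orthonormal.2 ?_
      intro h
      have h1 : (k : ℕ) = j := by simp [h]
      have := j.2
      have : (i : ℕ) < k := hk
      omega
    | zero => simp
    | add x y _ _ hx hy => simp [inner_add_right, hx, hy]
    | smul a x _ hx => simp [inner_smul_right, hx]
  refine le_of_sq_le_sq ?_ (by positivity)
  rw [hT, mul_pow, ← b.sum_sq_norm_inner_right v, Finset.mul_sum]
  refine Finset.sum_le_sum fun k _ => ?_
  rcases lt_or_ge i k with h | h
  · simp [hz k h]
  · rw [mul_pow]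
    have := hw h
    have := hw0 i
    gcongr

lemma sNum_diagOp_ge (b : OrthonormalBasis (Fin N) ℂ E) (w : Fin N → ℝ) (hw : Antitone w)
    (hw0 : ∀ k, 0 ≤ w k) (i : Fin N) : w i ≤ sNum (diagOp b (fun k => (w k : ℂ))) (i + 1) :=
  sNum_ge_of_diag b w hw hw0 (fun v => by
    rw [norm_diagOp_sq]; simp only [Complex.norm_real, Real.norm_eq_abs, abs_of_nonneg (hw0 _)]) i

lemma sNum_diagOp_le (b : OrthonormalBasis (Fin N) ℂ E) (w : Fin N → ℝ) (hw : Antitone w)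
    (hw0 : ∀ k, 0 ≤ w k) (i : Fin N) : sNum (diagOp b (fun k => (w k : ℂ))) (i + 1) ≤ w i := by
  let F := diagOp b (fun k => if k < i then (w k : ℂ) else 0)
  have hF : Module.rank ℂ (LinearMap.range (F : E →ₗ[ℂ] E)) < ((i + 1 : ℕ) : Cardinal) := by
    rw [← Module.finrank_eq_rank]
    norm_cast
    let f : Fin i → E := fun k => b (Fin.castLE (by omega) k)
    have h1 : LinearMap.range (F : E →ₗ[ℂ] E) ≤ Submodule.span ℂ (Set.range f) := by
      rintro _ ⟨v, rfl⟩
      rw [← b.sum_repr' v]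
      simp only [ContinuousLinearMap.coe_coe, map_sum, map_smul]
      refine Submodule.sum_mem _ fun k _ => Submodule.smul_mem _ _ ?_
      simp only [F, diagOp_basis]
      split_ifs with hk
      · exact Submodule.smul_mem _ _ (Submodule.subset_span ⟨⟨k, hk⟩, rfl⟩)
      · simp
    have h2 := Submodule.finrank_mono h1
    have h3 := finrank_range_le_card (R := ℂ) f
    simp only [Fintype.card_fin, Set.finrank] at h3
    omega
  refine (sNum_le_of_rank hF).trans ?_
  have : diagOp b (fun k => (w k : ℂ)) - F = diagOp b (fun k => if k < i then 0 else (w k : ℂ)) := by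
    refine clm_ext_basis b fun k => ?_
    simp only [F, sub_apply, diagOp_basis]
    split_ifs <;> simp
  rw [this]
  refine norm_diagOp_le b _ (hw0 i) fun k => ?_
  split_ifs with h
  · simpa using hw0 i
  · simp only [Complex.norm_real, Real.norm_eq_abs, abs_of_nonneg (hw0 _)]
    exact hw (not_lt.1 h)

lemma sNum_eq_zero_of_finrank_lt (T : E →L[ℂ] E) {n : ℕ} (hn : Module.finrank ℂ E < n) :
    sNum T n = 0 := by
  refine le_antisymm ?_ (sNum_nonneg _ _)
  have : Module.rank ℂ (LinearMap.range (T : E →ₗ[ℂ] E)) < (n : Cardinal) := by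
    rw [← Module.finrank_eq_rank]
    exact_mod_cast (Submodule.finrank_le _).trans_lt hn
  simpa using sNum_le_of_rank (T := T) this

lemma norm_det_le_prod_sNum (hN : Module.finrank ℂ E = N) (T : E →L[ℂ] E) :
    ‖LinearMap.det (T : E →ₗ[ℂ] E)‖ ≤ ∏ i : Fin N, sNum T (i + 1) := by
  have hS := (T : E →ₗ[ℂ] E).isPositive_adjoint_comp_self
  have hdet := hS.isSymmetric.det_eq_prod_eigenvalues hN
  have h1 : LinearMap.det (LinearMap.adjoint (T : E →ₗ[ℂ] E) ∘ₗ (T : E →ₗ[ℂ] E))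
      = ((‖LinearMap.det (T : E →ₗ[ℂ] E)‖ ^ 2 : ℝ) : ℂ) := by
    have ha : LinearMap.det (LinearMap.adjoint (T : E →ₗ[ℂ] E))
        = star (LinearMap.det (T : E →ₗ[ℂ] E)) := by
      rw [← LinearMap.det_toMatrix (stdOrthonormalBasis ℂ E).toBasis,
        LinearMap.toMatrix_adjoint, Matrix.det_conjTranspose, LinearMap.det_toMatrix]
    rw [LinearMap.det_comp, ha]
    simp [← Complex.conj_mul']
  set ev := hS.isSymmetric.eigenvalues hN
  set b := hS.isSymmetric.eigenvectorBasis hN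
  have hev0 : ∀ k, 0 ≤ ev k := fun k => hS.nonneg_eigenvalues hN k
  have h2 : ‖LinearMap.det (T : E →ₗ[ℂ] E)‖ ^ 2 = ∏ i, ev i := by
    have : ((‖LinearMap.det (T : E →ₗ[ℂ] E)‖ ^ 2 : ℝ) : ℂ) = ∏ i, ((ev i : ℝ) : ℂ) :=
      h1.symm.trans hdet
    exact_mod_cast this
  have h3 : ∀ v, ‖T v‖ ^ 2 = ∑ k, (Real.sqrt (ev k) * ‖inner ℂ (b k) v‖) ^ 2 := by
    intro v
    have e1 : inner ℂ (T v) (T v) = inner ℂ v ((LinearMap.adjoint (T : E →ₗ[ℂ] E) ∘ₗ (T : E →ₗ[ℂ] E)) v) := by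
      simp [LinearMap.adjoint_inner_right]
    have e2 := b.sum_inner_mul_inner v ((LinearMap.adjoint (T : E →ₗ[ℂ] E) ∘ₗ (T : E →ₗ[ℂ] E)) v)
    have e3 : ∀ k, inner ℂ (b k) ((LinearMap.adjoint (T : E →ₗ[ℂ] E) ∘ₗ (T : E →ₗ[ℂ] E)) v)
        = ev k * inner ℂ (b k) v := by
      intro k
      rw [← hS.isSymmetric (b k) v, hS.isSymmetric.apply_eigenvectorBasis hN k, inner_smul_left]
      simp only [RCLike.conj_ofReal]; rfl
    have e4 : ((‖T v‖ ^ 2 : ℝ) : ℂ) = ((∑ k, (Real.sqrt (ev k) * ‖inner ℂ (b k) v‖) ^ 2 : ℝ) : ℂ) := by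
      push_cast
      have e0 : inner ℂ (T v) (T v) = ((‖T v‖ : ℝ) : ℂ) ^ 2 := inner_self_eq_norm_sq_to_K _
      rw [← e0, e1, ← e2]
      refine Finset.sum_congr rfl fun k _ => ?_
      rw [e3, mul_pow]
      have : ((Real.sqrt (ev k) : ℂ)) ^ 2 = ev k := by
        rw [← Complex.ofReal_pow, Real.sq_sqrt (hev0 k)]
      rw [this, ← Complex.conj_mul', inner_conj_symm]
      ring
    exact_mod_cast e4
  refine le_of_sq_le_sq ?_ (Finset.prod_nonneg fun i _ => sNum_nonneg _ _)
  rw [h2, ← Finset.prod_pow]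
  refine Finset.prod_le_prod (fun i _ => hev0 i) fun i _ => ?_
  have := sNum_ge_of_diag b (fun k => Real.sqrt (ev k))
    (fun x y hxy => Real.sqrt_le_sqrt (hS.isSymmetric.eigenvalues_antitone hN hxy))
    (fun k => Real.sqrt_nonneg _) h3 i
  calc ev i = Real.sqrt (ev i) ^ 2 := (Real.sq_sqrt (hev0 i)).symm
    _ ≤ _ := by gcongr

/-- main determinant bound -/
lemma norm_det_bound (b : OrthonormalBasis (Fin N) ℂ E) (lam : Fin N → ℂ) (K : E →L[ℂ] E) (z : ℂ)
    (d : Fin N → ℝ) {δ : ℝ} (hδ : 0 < δ) (hd : ∀ k, δ ≤ d k) (hl : ∀ k, ‖1 - z * lam k‖ ≤ d k) :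
    ‖LinearMap.det ((1 - z • (diagOp b lam + K) : E →L[ℂ] E) : E →ₗ[ℂ] E)‖
      ≤ (∏ k, d k) * ∏ i : Fin N, (1 + ‖z‖ / δ * sNum K (i + 1)) := by
  have hN : Module.finrank ℂ E = N := by
    rw [Module.finrank_eq_card_basis b.toBasis]; simp
  have hd0 : ∀ k, 0 < d k := fun k => hδ.trans_le (hd k)
  have hdc : ∀ k, (d k : ℂ) ≠ 0 := fun k => by exact_mod_cast (hd0 k).ne'
  set D := diagOp b (fun k => (d k : ℂ)) with hD
  set Di := diagOp b (fun k => ((d k : ℂ))⁻¹) with hDi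
  set U := diagOp b (fun k => (1 - z * lam k) / d k) with hU
  have e1 : (1 - z • (diagOp b lam + K) : E →L[ℂ] E) = D * (U + (-z) • (Di * K)) := by
    have a1 : D * U = 1 - z • diagOp b lam := by
      rw [hD, hU, diagOp_mul]
      refine clm_ext_basis b fun k => ?_
      simp only [diagOp_basis, sub_apply, smul_apply,
        one_apply_eq_self]
      rw [mul_div_cancel₀ _ (hdc k), sub_smul, one_smul, mul_smul]
    have a2 : D * Di = 1 := by
      rw [hD, hDi, diagOp_mul, ← diagOp_one b]
      congr 1; ext k; exact mul_inv_cancel₀ (hdc k)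
    rw [mul_add, a1, mul_smul_comm, ← mul_assoc, a2, one_mul, smul_add, neg_smul]
    abel
  have hUn : ‖U‖ ≤ 1 := norm_diagOp_le b _ zero_le_one fun k => by
    rw [norm_div, Complex.norm_real, Real.norm_eq_abs, abs_of_pos (hd0 k), div_le_one (hd0 k)]
    exact hl k
  have hDin : ‖Di‖ ≤ δ⁻¹ := norm_diagOp_le b _ (by positivity) fun k => by
    rw [norm_inv, Complex.norm_real, Real.norm_eq_abs, abs_of_pos (hd0 k)]
    exact inv_anti₀ hδ (hd k)
  have e2 : LinearMap.det ((D * (U + (-z) • (Di * K)) : E →L[ℂ] E) : E →ₗ[ℂ] E)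
      = LinearMap.det (D : E →ₗ[ℂ] E) * LinearMap.det ((U + (-z) • (Di * K) : E →L[ℂ] E) : E →ₗ[ℂ] E) := by
    rw [← LinearMap.det_comp]; rfl
  rw [e1, e2, norm_mul, det_diagOp, norm_prod]
  have e3 : ∏ k, ‖(d k : ℂ)‖ = ∏ k, d k := Finset.prod_congr rfl fun k _ => by
    rw [Complex.norm_real, Real.norm_eq_abs, abs_of_pos (hd0 k)]
  rw [e3]
  refine mul_le_mul_of_nonneg_left ?_ (Finset.prod_nonneg fun k _ => (hd0 k).le)
  refine (norm_det_le_prod_sNum hN _).trans ?_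
  refine Finset.prod_le_prod (fun i _ => sNum_nonneg _ _) fun i _ => ?_
  have s1 := sNum_le_add_norm (U + (-z) • (Di * K)) (((-z) • Di) * K) (i + 1)
  have s2 : U + (-z) • (Di * K) - ((-z) • Di) * K = U := by rw [smul_mul_assoc]; abel
  rw [s2] at s1
  have s3 := sNum_mul_left_le ((-z) • Di) K (i + 1)
  have s4 : ‖(-z) • Di‖ ≤ ‖z‖ / δ := by
    rw [norm_smul, norm_neg, div_eq_mul_inv]; gcongr
  have s5 := mul_le_mul_of_nonneg_right s4 (sNum_nonneg K (i + 1))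
  linarith

/-- positive operators are diagonal -/
lemma exists_diag {B : E →L[ℂ] E} (hB : (B : E →ₗ[ℂ] E).IsPositive) (hN : Module.finrank ℂ E = N) :
    ∃ (b : OrthonormalBasis (Fin N) ℂ E) (w : Fin N → ℝ), Antitone w ∧ (∀ k, 0 ≤ w k) ∧
      B = diagOp b (fun k => (w k : ℂ)) := by
  refine ⟨hB.isSymmetric.eigenvectorBasis hN, hB.isSymmetric.eigenvalues hN,
    hB.isSymmetric.eigenvalues_antitone hN, fun k => hB.nonneg_eigenvalues hN k, ?_⟩
  refine clm_ext_basis (hB.isSymmetric.eigenvectorBasis hN) fun k => ?_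
  rw [diagOp_basis]
  exact hB.isSymmetric.apply_eigenvectorBasis hN k

lemma differentiable_det (A : E →L[ℂ] E) :
    Differentiable ℂ fun z : ℂ => LinearMap.det ((1 - z • A : E →L[ℂ] E) : E →ₗ[ℂ] E) := by
  let b := (stdOrthonormalBasis ℂ E).toBasis
  have : (fun z : ℂ => LinearMap.det ((1 - z • A : E →L[ℂ] E) : E →ₗ[ℂ] E)) =
      fun z : ℂ => ((1 : Matrix _ _ ℂ) - z • LinearMap.toMatrix b b (A : E →ₗ[ℂ] E)).det := by
    ext z
    rw [← LinearMap.det_toMatrix b]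
    congr 1
    have : ((1 - z • A : E →L[ℂ] E) : E →ₗ[ℂ] E) = LinearMap.id - z • (A : E →ₗ[ℂ] E) := rfl
    rw [this, map_sub, map_smul, LinearMap.toMatrix_id]
  rw [this]
  simp only [Matrix.det_apply, Matrix.sub_apply, Matrix.smul_apply]
  fun_prop

end FinDim

open Filter Topology MeasureTheory

section Compress
universe u
variable {H : Type u} [NormedAddCommGroup H] [InnerProductSpace ℂ H]

/-- compression to a subspace -/
noncomputable def compress (V : Submodule ℂ H) [V.HasOrthogonalProjection] (T : H →L[ℂ] H) :
    V →L[ℂ] V := V.orthogonalProjection ∘L T ∘L V.subtypeL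

lemma compress_coe (V : Submodule ℂ H) [V.HasOrthogonalProjection] (T : H →L[ℂ] H) (v : V) :
    (compress V T v : H) = V.starProjection (T v) := rfl

lemma sNum_compress_le (V : Submodule ℂ H) [V.HasOrthogonalProjection] (T : H →L[ℂ] H) (n : ℕ) :
    sNum (compress V T) n ≤ sNum T n :=
  sNum_comp_le_of_le_one T _ _ (V.orthogonalProjection_norm_le) (V.norm_subtypeL_le) n

lemma sNum_le_compress (V : Submodule ℂ H) [V.HasOrthogonalProjection] (T : H →L[ℂ] H) (n : ℕ) :
    sNum T n ≤ sNum (compress V T) n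
      + ‖T - V.starProjection ∘L T ∘L V.starProjection‖ := by
  have h1 := sNum_le_add_norm T (V.starProjection ∘L T ∘L V.starProjection) n
  have h2 := sNum_comp_le_of_le_one (compress V T) V.subtypeL V.orthogonalProjection
    (V.norm_subtypeL_le) (V.orthogonalProjection_norm_le) n
  have h3 : V.subtypeL ∘L compress V T ∘L V.orthogonalProjection
      = V.starProjection ∘L T ∘L V.starProjection := rfl
  rw [h3] at h2
  linarith

lemma compress_add (V : Submodule ℂ H) [V.HasOrthogonalProjection] (S T : H →L[ℂ] H) :
    compress V (S + T) = compress V S + compress V T := by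
  ext v; simp [compress]

lemma compress_isPositive (V : Submodule ℂ H) [V.HasOrthogonalProjection] {B : H →L[ℂ] H}
    (hB : B.IsPositive) : (compress V B : V →ₗ[ℂ] V).IsPositive := by
  have key : ∀ x y : V, inner ℂ (compress V B x) y = inner ℂ (B x) (y : H) := by
    intro x y
    simp [compress]
  refine ⟨fun x y => ?_, fun x => ?_⟩
  · have h2 : inner ℂ x (compress V B y) = inner ℂ (x : H) (B y) := by
      rw [← inner_conj_symm, key, inner_conj_symm]
    simp only [ContinuousLinearMap.coe_coe]
    rw [key, h2]
    exact hB.isSymmetric _ _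
  · simp only [ContinuousLinearMap.coe_coe]
    rw [key]
    exact hB.re_inner_nonneg_left _

lemma starProjection_comp_of_le {V : Submodule ℂ H} [V.HasOrthogonalProjection] {F : H →L[ℂ] H}
    (h : LinearMap.range (F : H →ₗ[ℂ] H) ≤ V) : V.starProjection ∘L F = F := by
  ext v
  simp only [ContinuousLinearMap.comp_apply]
  exact Submodule.starProjection_eq_self_iff.2 (h ⟨v, rfl⟩)

lemma norm_sub_compress_le [CompleteSpace H] {V : Submodule ℂ H} [V.HasOrthogonalProjection]
    {T F : H →L[ℂ] H}
    (h : LinearMap.range (F : H →ₗ[ℂ] H) ≤ V)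
    (h' : LinearMap.range ((ContinuousLinearMap.adjoint F : H →L[ℂ] H) : H →ₗ[ℂ] H) ≤ V) :
    ‖T - V.starProjection ∘L T ∘L V.starProjection‖ ≤ 2 * ‖T - F‖ := by
  have h1 := starProjection_comp_of_le h
  have h2 := congrArg ContinuousLinearMap.adjoint (starProjection_comp_of_le h')
  rw [ContinuousLinearMap.adjoint_comp, ContinuousLinearMap.adjoint_adjoint,
    (isSelfAdjoint_starProjection V).adjoint_eq] at h2
  have e : T - V.starProjection ∘L T ∘L V.starProjection
      = (T - F) - V.starProjection ∘L (T - F) ∘L V.starProjection := by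
    have : V.starProjection ∘L (T - F) ∘L V.starProjection =
      V.starProjection ∘L T ∘L V.starProjection - V.starProjection ∘L F ∘L V.starProjection := by
      ext v; simp
    rw [this, h2, h1]; abel
  rw [e]
  have hP := V.starProjection_norm_le
  have h3 : ‖V.starProjection ∘L (T - F) ∘L V.starProjection‖ ≤ ‖T - F‖ := by
    refine (ContinuousLinearMap.opNorm_comp_le _ _).trans ?_
    have := ContinuousLinearMap.opNorm_comp_le (T - F) V.starProjection
    calc _ ≤ 1 * (‖T - F‖ * 1) := by
          gcongr
          exact this.trans (by gcongr)
      _ = _ := by ring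
  have := norm_sub_le (T - F) (V.starProjection ∘L (T - F) ∘L V.starProjection)
  linarith

lemma exists_finrank_approx {T : H →L[ℂ] H} (hT : Tendsto (fun n => sNum T n) atTop (𝓝 0))
    {ε : ℝ} (hε : 0 < ε) : ∃ (F : H →L[ℂ] H) (n : ℕ),
      Module.rank ℂ (LinearMap.range (F : H →ₗ[ℂ] H)) < (n : Cardinal) ∧ ‖T - F‖ < ε := by
  obtain ⟨n, hn, hn1⟩ := ((hT.eventually (gt_mem_nhds hε)).and (eventually_ge_atTop 1)).exists
  obtain ⟨F, h1, h2⟩ := exists_of_sNum_lt hn1 hn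
  exact ⟨F, n, h1, h2⟩

lemma exists_approx [CompleteSpace H] {S T : H →L[ℂ] H}
    (hS : Tendsto (fun n => sNum S n) atTop (𝓝 0)) (hT : Tendsto (fun n => sNum T n) atTop (𝓝 0))
    {ε : ℝ} (hε : 0 < ε) : ∃ (V : Submodule ℂ H) (_ : FiniteDimensional ℂ V),
      ‖S - V.starProjection ∘L S ∘L V.starProjection‖ ≤ ε ∧
      ‖T - V.starProjection ∘L T ∘L V.starProjection‖ ≤ ε := by
  obtain ⟨F, n, hF, hF2⟩ := exists_finrank_approx hS (half_pos hε)
  obtain ⟨G, m, hG, hG2⟩ := exists_finrank_approx hT (half_pos hε)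
  have i1 := finiteDimensional_range_of_rank_lt hF
  have i2 := finiteDimensional_range_of_rank_lt (rank_adjoint_lt hF)
  have i3 := finiteDimensional_range_of_rank_lt hG
  have i4 := finiteDimensional_range_of_rank_lt (rank_adjoint_lt hG)
  refine ⟨(LinearMap.range (F : H →ₗ[ℂ] H) ⊔
    LinearMap.range ((ContinuousLinearMap.adjoint F : H →L[ℂ] H) : H →ₗ[ℂ] H)) ⊔
    (LinearMap.range (G : H →ₗ[ℂ] H) ⊔
    LinearMap.range ((ContinuousLinearMap.adjoint G : H →L[ℂ] H) : H →ₗ[ℂ] H)),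
    inferInstance, ?_, ?_⟩
  · refine (norm_sub_compress_le (F := F) ?_ ?_).trans (by linarith)
    · exact le_sup_left.trans le_sup_left
    · exact le_sup_right.trans le_sup_left
  · refine (norm_sub_compress_le (F := G) ?_ ?_).trans (by linarith)
    · exact le_sup_left.trans le_sup_right
    · exact le_sup_right.trans le_sup_right

lemma exists_inv_bound [CompleteSpace H] {A : H →L[ℂ] H} (hA : ∀ z : ℂ, IsUnit (1 - z • A))
    (R : ℝ) : ∃ M > 0, ∀ z : ℂ, ‖z‖ ≤ R → ∀ v : H, ‖v‖ ≤ M * ‖(1 - z • A) v‖ := by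
  have hc : Continuous fun z : ℂ => Ring.inverse (1 - z • A) := by
    rw [continuous_iff_continuousAt]
    intro z
    obtain ⟨u, hu⟩ := hA z
    have h1 : ContinuousAt Ring.inverse (1 - z • A) := by
      rw [← hu]; exact NormedRing.inverse_continuousAt u
    have h2 : ContinuousAt (fun z : ℂ => 1 - z • A) z := by fun_prop
    exact ContinuousAt.comp (f := fun z : ℂ => 1 - z • A) h1 h2
  obtain ⟨M, hM⟩ := (isCompact_closedBall (0 : ℂ) R).exists_bound_of_continuousOn hc.continuousOn
  refine ⟨max M 1, by positivity, fun z hz v => ?_⟩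
  have h1 := hM z (by simpa using hz)
  have h2 : Ring.inverse (1 - z • A) ((1 - z • A) v) = v := by
    have := Ring.inverse_mul_cancel _ (hA z)
    have := congrArg (fun T : H →L[ℂ] H => T v) this
    simpa using this
  calc ‖v‖ = ‖Ring.inverse (1 - z • A) ((1 - z • A) v)‖ := by rw [h2]
    _ ≤ ‖Ring.inverse (1 - z • A)‖ * ‖(1 - z • A) v‖ := ContinuousLinearMap.le_opNorm _ _
    _ ≤ _ := by gcongr; exact h1.trans (le_max_left _ _)

lemma exists_det_ne_zero [CompleteSpace H] {A : H →L[ℂ] H} (hA : ∀ z : ℂ, IsUnit (1 - z • A))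
    {R : ℝ} (hR : 0 ≤ R) : ∃ ε > 0, ∀ (V : Submodule ℂ H) [FiniteDimensional ℂ V],
      ‖A - V.starProjection ∘L A ∘L V.starProjection‖ ≤ ε → ∀ z : ℂ, ‖z‖ ≤ R →
        LinearMap.det ((1 - z • compress V A : V →L[ℂ] V) : V →ₗ[ℂ] V) ≠ 0 := by
  obtain ⟨M, hM0, hM⟩ := exists_inv_bound hA R
  refine ⟨1 / (2 * M * (R + 1)), by positivity, fun V _ hV z hz hdet => ?_⟩
  obtain ⟨v, hv, hv0⟩ := Submodule.exists_mem_ne_zero_of_ne_bot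
    (LinearMap.bot_lt_ker_of_det_eq_zero hdet).ne'
  have h1 : v = z • compress V A v := by
    have : v - z • compress V A v = 0 := by simpa using LinearMap.mem_ker.1 hv
    exact sub_eq_zero.1 this
  have h2 : (v : H) = z • V.starProjection (A (V.starProjection v)) := by
    have e : V.starProjection (v : H) = v := Submodule.starProjection_eq_self_iff.2 v.2
    rw [e, ← compress_coe]
    exact congrArg Subtype.val h1
  have h3 := hM z hz v
  have h4 : (1 - z • A) (v : H)
      = -(z • (A - V.starProjection ∘L A ∘L V.starProjection) (v : H)) := by
    simp only [sub_apply, smul_apply, one_apply_eq_self, ContinuousLinearMap.comp_apply, smul_sub]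
    rw [← h2]; abel
  have hv1 : 0 < ‖(v : H)‖ := by simpa using hv0
  have h5 : ‖(1 - z • A) (v : H)‖ ≤ R * (1 / (2 * M * (R + 1)) * ‖(v : H)‖) := by
    rw [h4, norm_neg, norm_smul]
    gcongr
    exact (ContinuousLinearMap.le_opNorm _ _).trans (by gcongr)
  have h6 : ‖(v : H)‖ ≤ M * (R * (1 / (2 * M * (R + 1)) * ‖(v : H)‖)) := h3.trans (by gcongr)
  have h7 : M * (R * (1 / (2 * M * (R + 1)) * ‖(v : H)‖)) = (R / (R + 1)) * (‖(v : H)‖ / 2) := by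
    field_simp
  have h8 : R / (R + 1) ≤ 1 := by rw [div_le_one (by positivity)]; linarith
  nlinarith

/-- the finite dimensional data extracted from the operators -/
theorem exists_data [CompleteSpace H] {B K : H →L[ℂ] H} (hB : B.IsPositive)
    (hBs : Tendsto (fun n => sNum B n) atTop (𝓝 0))
    (hAs : Tendsto (fun n => sNum (B + K) n) atTop (𝓝 0))
    (hA : ∀ z : ℂ, IsUnit (1 - z • (B + K))) {R ε : ℝ} (hR : 0 ≤ R) (hε : 0 < ε) :
    ∃ (N : ℕ) (lam : ℕ → ℝ) (p : ℂ → ℂ), (∀ k, 0 ≤ lam k) ∧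
      Differentiable ℂ p ∧ p 0 = 1 ∧ (∀ z, ‖z‖ ≤ R → p z ≠ 0) ∧
      (∀ j, lam j ≤ sNum B (j + 1)) ∧
      (∀ j, ε < sNum B (j + 1) → j < N ∧ sNum B (j + 1) - ε ≤ lam j) ∧
      (∀ (z : ℂ) (d : ℕ → ℝ) (δ : ℝ), 0 < δ → (∀ k, δ ≤ d k) → (∀ k, ‖1 - z * lam k‖ ≤ d k) →
        ‖p z‖ ≤ (∏ k ∈ Finset.range N, d k) *
          ∏ i ∈ Finset.range N, (1 + ‖z‖ / δ * sNum K (i + 1))) ∧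
      (∀ z : ℂ, ‖p z‖ ≤ ∏ i ∈ Finset.range N, (1 + ‖z‖ * sNum (B + K) (i + 1))) := by
  obtain ⟨ε1, hε1, hdet⟩ := exists_det_ne_zero hA hR
  obtain ⟨V, hV, h1, h2⟩ := exists_approx hBs hAs (lt_min hε hε1)
  obtain ⟨N, hN⟩ : ∃ N, Module.finrank ℂ V = N := ⟨_, rfl⟩
  obtain ⟨b, w, hw, hw0, hBw⟩ := exists_diag (compress_isPositive V hB) hN
  let lam : ℕ → ℝ := fun k => if h : k < N then w ⟨k, h⟩ else 0
  have hlam : ∀ k : Fin N, lam k = w k := fun k => by simp [lam]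
  refine ⟨N, lam, fun z => LinearMap.det ((1 - z • compress V (B + K) : V →L[ℂ] V) : V →ₗ[ℂ] V),
    ?_, differentiable_det _, ?_, ?_, ?_, ?_, ?_, ?_⟩
  · intro k
    simp only [lam]
    split_ifs
    · exact hw0 _
    · exact le_rfl
  · have : ((1 - (0 : ℂ) • compress V (B + K) : V →L[ℂ] V) : V →ₗ[ℂ] V) = LinearMap.id := by
      ext v; simp
    simp only [this, LinearMap.det_id]
  · exact hdet V (h2.trans (min_le_right _ _))
  · intro j
    simp only [lam]
    split_ifs with h
    · refine (sNum_diagOp_ge b w hw hw0 ⟨j, h⟩).trans ?_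
      rw [← hBw]
      exact sNum_compress_le _ _ _
    · exact sNum_nonneg _ _
  · intro j hj
    have h3 := sNum_le_compress V B (j + 1)
    have h4 := h1.trans (min_le_left _ _)
    have hjN : j < N := by
      by_contra hc
      have := sNum_eq_zero_of_finrank_lt (compress V B) (n := j + 1) (by omega)
      linarith
    refine ⟨hjN, ?_⟩
    have h5 := sNum_diagOp_le b w hw hw0 ⟨j, hjN⟩
    rw [← hBw] at h5
    simp only [lam, hjN, dite_true]
    linarith
  · intro z d δ hδ hd hl
    have := norm_det_bound b (fun k => (w k : ℂ)) (compress V K) z (fun k => d k) hδ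
      (fun k => hd k) (fun k => by rw [← hlam]; exact hl k)
    rw [← hBw, ← compress_add] at this
    refine this.trans ?_
    rw [Finset.prod_range, Finset.prod_range]
    have hd0 : ∀ k, 0 ≤ d k := fun k => hδ.le.trans (hd k)
    have := fun i => sNum_nonneg (compress V K) i
    refine mul_le_mul_of_nonneg_left ?_ (Finset.prod_nonneg fun k _ => hd0 _)
    refine Finset.prod_le_prod (fun i _ => by have := this (i + 1); positivity) fun i _ => ?_
    gcongr
    exact sNum_compress_le _ _ _
  · intro z
    have := norm_det_bound b (fun k => 0) (compress V (B + K)) z (fun k => 1) one_pos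
      (fun k => le_rfl) (fun k => by simp)
    have h0 : diagOp b (fun k => (0 : ℂ)) = 0 := clm_ext_basis b fun k => by simp [diagOp_basis]
    rw [h0, zero_add] at this
    refine this.trans ?_
    rw [Finset.prod_range]
    simp only [Finset.prod_const_one, one_mul, div_one]
    have := fun i => sNum_nonneg (compress V (B + K)) i
    refine Finset.prod_le_prod (fun i _ => by have := this (i + 1); positivity) fun i _ => ?_
    gcongr
    exact sNum_compress_le _ _ _

end Compress

open Filter Topology MeasureTheory

/-- holomorphic logarithm on a disc -/
lemma exists_log_ball {p : ℂ → ℂ} (hp : Differentiable ℂ p) (hp0 : p 0 = 1) {R : ℝ} (hR : 0 < R)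
    (hne : ∀ z, ‖z‖ ≤ R → p z ≠ 0) :
    ∃ g : ℂ → ℂ, DifferentiableOn ℂ g (Metric.ball 0 R) ∧ g 0 = 0 ∧
      ∀ z ∈ Metric.ball (0 : ℂ) R, Complex.exp (g z) = p z := by
  have hne' : ∀ z ∈ Metric.ball (0 : ℂ) R, p z ≠ 0 := fun z hz => hne z (by
    rw [mem_ball_zero_iff] at hz; exact hz.le)
  have hd : DifferentiableOn ℂ (fun z => deriv p z / p z) (Metric.ball 0 R) := by
    refine DifferentiableOn.div ?_ hp.differentiableOn hne'
    exact (hp.differentiableOn (s := Set.univ)).deriv isOpen_univ |>.mono (Set.subset_univ _)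
  obtain ⟨g, hg0, hg⟩ := hd.isExactOn_ball.with_val_at 0 0
  refine ⟨g, fun z hz => (hg z hz).differentiableAt.differentiableWithinAt, hg0, ?_⟩
  have h0 : (0 : ℂ) ∈ Metric.ball (0 : ℂ) R := by simpa using hR
  have key : ∀ z ∈ Metric.ball (0 : ℂ) R,
      Complex.exp (-g z) * p z = Complex.exp (-g 0) * p 0 := by
    intro z hz
    refine (convex_ball (0 : ℂ) R).is_const_of_fderivWithin_eq_zero (𝕜 := ℂ)
      (f := fun z => Complex.exp (-g z) * p z) ?_ ?_ hz h0
    · intro x hx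
      exact ((hg x hx).differentiableAt.neg.cexp.mul (hp x)).differentiableWithinAt
    · intro x hx
      have h1 : HasDerivAt (fun z => Complex.exp (-g z) * p z)
          (Complex.exp (-g x) * (-(deriv p x / p x)) * p x + Complex.exp (-g x) * deriv p x) x :=
        ((hg x hx).neg.cexp).mul (hp x).hasDerivAt
      have h2 : Complex.exp (-g x) * (-(deriv p x / p x)) * p x + Complex.exp (-g x) * deriv p x
          = 0 := by
        have := hne' x hx
        field_simp
        ring
      rw [h2] at h1
      rw [fderivWithin_of_isOpen Metric.isOpen_ball hx, h1.hasFDerivAt.fderiv]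
      ext; simp
  intro z hz
  have := key z hz
  rw [hg0, hp0, neg_zero, Complex.exp_zero, one_mul, Complex.exp_neg] at this
  have h := Complex.exp_ne_zero (g z)
  field_simp at this
  exact this.symm

lemma log_ball_bound {p : ℂ → ℂ} (hp : Differentiable ℂ p) (hp0 : p 0 = 1) {R M : ℝ} (hR : 0 < R)
    (hM : 0 < M) (hne : ∀ z, ‖z‖ ≤ R → p z ≠ 0) (hb : ∀ z, ‖z‖ ≤ R → ‖p z‖ ≤ Real.exp M)
    {z : ℂ} (hz : ‖z‖ < R) : Real.exp (-(2 * M * ‖z‖ / (R - ‖z‖))) ≤ ‖p z‖ := by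
  obtain ⟨g, hg, hg0, hgp⟩ := exists_log_ball hp hp0 hR hne
  have hz' : z ∈ Metric.ball (0 : ℂ) R := by simpa using hz
  have h := Complex.borelCaratheodory_zero hM hg (by
    intro w hw
    have h1 := hgp w hw
    have h2 := hb w (by rw [mem_ball_zero_iff] at hw; exact hw.le)
    rw [← h1, Complex.norm_exp, Real.exp_le_exp] at h2
    exact h2) hR hz' hg0
  rw [← hgp z hz', Complex.norm_exp, Real.exp_le_exp]
  have := Complex.abs_re_le_norm (g z)
  have := neg_abs_le (g z).re
  linarith

/-- second order version, used for `α = 1` -/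
lemma log_ball_bound_two {p : ℂ → ℂ} (hp : Differentiable ℂ p) (hp0 : p 0 = 1) {R M M2 : ℝ}
    (hR : 2 ≤ R) (hM : 0 < M) (hM2 : 0 < M2) (hne : ∀ z, ‖z‖ ≤ R → p z ≠ 0)
    (hb : ∀ z, ‖z‖ ≤ R → ‖p z‖ ≤ Real.exp M) (hb2 : ∀ z, ‖z‖ ≤ 2 → ‖p z‖ ≤ Real.exp M2)
    {z : ℂ} (hz : ‖z‖ < R / 2) :
    Real.exp (-(‖z‖ * (2 * M2 + 16 * M / R ^ 2 * ‖z‖))) ≤ ‖p z‖ := by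
  have hR0 : 0 < R := by linarith
  obtain ⟨g, hg, hg0, hgp⟩ := exists_log_ball hp hp0 hR0 hne
  have hre : ∀ w, ‖w‖ < R → (g w).re ≤ M := fun w hw => by
    have h1 := hgp w (by simpa using hw)
    have h2 := hb w hw.le
    rwa [← h1, Complex.norm_exp, Real.exp_le_exp] at h2
  have hre2 : ∀ w, ‖w‖ < 2 → (g w).re ≤ M2 := fun w hw => by
    have h1 := hgp w (by simp; linarith)
    have h2 := hb2 w hw.le
    rwa [← h1, Complex.norm_exp, Real.exp_le_exp] at h2
  -- first order bounds
  have hB1 : ∀ w, ‖w‖ < R / 2 → ‖g w‖ ≤ 4 * M / R * ‖w‖ := by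
    intro w hw
    have h := Complex.borelCaratheodory_zero (z := w) hM hg (by
      intro w hw; exact hre w (by simpa using hw)) hR0 (by simp; linarith) hg0
    refine h.trans ?_
    rw [div_le_iff₀ (by linarith)]
    have : 4 * M / R * ‖w‖ * (R - ‖w‖) - 2 * M * ‖w‖ = 4 * M / R * ‖w‖ * (R / 2 - ‖w‖) := by
      field_simp; ring
    have h2 : 0 ≤ 4 * M / R * ‖w‖ * (R / 2 - ‖w‖) :=
      mul_nonneg (by positivity) (by linarith)
    linarith
  have hB2 : ∀ w, ‖w‖ < 1 → ‖g w‖ ≤ 2 * M2 * ‖w‖ := by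
    intro w hw
    have h := Complex.borelCaratheodory_zero (z := w) (R := 2) hM2
      (hg.mono (Metric.ball_subset_ball hR)) (by
      intro w hw; exact hre2 w (by simpa using hw)) two_pos (by simp; linarith) hg0
    refine h.trans ?_
    rw [div_le_iff₀ (by linarith)]
    have h2 : 0 ≤ 2 * M2 * ‖w‖ * (1 - ‖w‖) :=
      mul_nonneg (by positivity) (by linarith)
    nlinarith
  have hgd : DifferentiableAt ℂ g 0 := hg.differentiableAt (Metric.isOpen_ball.mem_nhds (by simpa))
  have hd0 : ‖deriv g 0‖ ≤ 2 * M2 := by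
    refine HasDerivAt.le_of_lip' (x₀ := 0) hgd.hasDerivAt (by positivity) ?_
    filter_upwards [Metric.ball_mem_nhds (0 : ℂ) one_pos] with w hw
    rw [hg0, sub_zero, sub_zero]
    exact hB2 w (by simpa using hw)
  have hd1 : ‖deriv g 0‖ ≤ 4 * M / R := by
    refine HasDerivAt.le_of_lip' (x₀ := 0) hgd.hasDerivAt (by positivity) ?_
    filter_upwards [Metric.ball_mem_nhds (0 : ℂ) (half_pos hR0)] with w hw
    rw [hg0, sub_zero, sub_zero]
    exact hB1 w (by simpa using hw)
  have hsl : DifferentiableOn ℂ (dslope g 0) (Metric.ball 0 (R / 2)) :=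
    (Complex.differentiableOn_dslope (Metric.ball_mem_nhds (0 : ℂ) (half_pos hR0))).2
      (hg.mono (Metric.ball_subset_ball (by linarith)))
  have hslb : ∀ w, ‖w‖ < R / 2 → ‖dslope g 0 w‖ ≤ 4 * M / R := by
    intro w hw
    rcases eq_or_ne w 0 with rfl | h0
    · rw [dslope_same]; exact hd1
    · rw [dslope_of_ne _ h0, slope_def_field, hg0, sub_zero, sub_zero, norm_div,
        div_le_iff₀ (norm_pos_iff.2 h0)]
      exact hB1 w hw
  have hS := Complex.dist_le_div_mul_dist_of_mapsTo_ball (R₂ := 8 * M / R) hsl (by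
    intro w hw
    rw [mem_ball_zero_iff] at hw
    have h1 := hslb w hw
    have h2 := hslb 0 (by simpa using hR0)
    rw [Metric.mem_closedBall, dist_eq_norm]
    refine (norm_sub_le _ _).trans ?_
    have : 8 * M / R = 4 * M / R + 4 * M / R := by ring
    linarith) (z := z) (by simpa using hz)
  rw [dist_zero_right, dist_eq_norm, dslope_same] at hS
  have hgz : g z = z * dslope g 0 z := by
    have := sub_smul_dslope g 0 z
    rw [hg0, sub_zero, sub_zero, smul_eq_mul] at this
    exact this.symm
  have hn : ‖dslope g 0 z‖ ≤ 2 * M2 + 16 * M / R ^ 2 * ‖z‖ := by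
    have h1 : ‖dslope g 0 z‖ ≤ ‖deriv g 0‖ + ‖dslope g 0 z - deriv g 0‖ := by
      have := norm_add_le (deriv g 0) (dslope g 0 z - deriv g 0)
      simpa using this
    have h2 : 8 * M / R / (R / 2) = 16 * M / R ^ 2 := by field_simp; ring
    rw [h2] at hS
    linarith
  rw [← hgp z (by simp; linarith), Complex.norm_exp, Real.exp_le_exp]
  have h1 := Complex.abs_re_le_norm (g z)
  have h2 := neg_abs_le (g z).re
  rw [hgz, norm_mul] at h1
  have := mul_le_mul_of_nonneg_left hn (norm_nonneg z)
  rw [hgz] at *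
  linarith

open Filter Topology MeasureTheory

lemma log_one_add_le_min {x : ℝ} (hx : 0 ≤ x) : Real.log (1 + x) ≤ 2 * min x (√x) := by
  have h1 : Real.log (1 + x) ≤ x := by
    have := Real.log_le_sub_one_of_pos (show 0 < 1 + x by linarith)
    linarith
  have hs := Real.sqrt_nonneg x
  have h2 : Real.log (1 + x) ≤ 2 * √x := by
    have h3 : 1 + x ≤ (1 + √x) ^ 2 := by
      have := Real.sq_sqrt hx
      nlinarith
    have h4 := Real.log_le_log (by linarith) h3
    rw [Real.log_pow] at h4
    have := Real.log_le_sub_one_of_pos (show 0 < 1 + √x by linarith)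
    push_cast at h4
    linarith
  rcases min_cases x (√x) with h | h <;> rw [h.1] <;> linarith

lemma norm_log_bound {δ : ℝ} (hδ : 0 < δ) :
    ∃ C : ℝ, 0 ≤ C ∧ ∀ z : ℂ, δ ≤ ‖1 - z‖ → ‖Complex.log (1 - z)‖ ≤ C * min ‖z‖ (√‖z‖) := by
  refine ⟨4 * (3 + |Real.log δ| + Real.pi), by positivity, fun z hz => ?_⟩
  have hpi := Real.pi_pos
  have hL := abs_nonneg (Real.log δ)
  have hn := norm_nonneg z
  have hsq := Real.sq_sqrt hn
  have hsn := Real.sqrt_nonneg ‖z‖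
  rcases le_total ‖z‖ (1 / 2) with h | h
  · have h1 := Complex.norm_log_one_add_half_le_self (z := -z) (by simpa using h)
    rw [norm_neg, ← sub_eq_add_neg] at h1
    have h2 : ‖z‖ ≤ √‖z‖ := Real.le_sqrt_of_sq_le (by nlinarith)
    rw [min_eq_left h2]
    nlinarith
  · have h1 : ‖Complex.log (1 - z)‖ ≤ |Real.log ‖1 - z‖| + Real.pi := by
      refine (Complex.norm_le_abs_re_add_abs_im _).trans ?_
      rw [Complex.log_re, Complex.log_im]
      have := Complex.abs_arg_le_pi (1 - z)
      linarith
    have h2 : Real.log ‖1 - z‖ ≤ 2 * min ‖z‖ (√‖z‖) := by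
      refine le_trans ?_ (log_one_add_le_min hn)
      refine Real.log_le_log (by linarith) ?_
      refine (norm_sub_le _ _).trans (by simp)
    have h3 : Real.log δ ≤ Real.log ‖1 - z‖ := Real.log_le_log hδ hz
    have h4 : 1 / 2 ≤ min ‖z‖ (√‖z‖) := by
      refine le_min h (Real.le_sqrt_of_sq_le (by linarith))
    have h5 : |Real.log ‖1 - z‖| ≤ 2 * min ‖z‖ (√‖z‖) + |Real.log δ| := by
      rw [abs_le]
      have := neg_abs_le (Real.log δ)
      constructor <;> linarith
    nlinarith

lemma norm_one_sub_ge {θ φ x : ℝ} (hθ0 : 0 ≤ θ) (hθ : θ ≤ Real.pi / 2) (h1 : θ ≤ φ)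
    (h2 : φ ≤ Real.pi) (hx : 0 ≤ x) :
    Real.sin θ ≤ ‖1 - (x : ℂ) * Complex.exp (φ * Complex.I)‖ := by
  have hpi := Real.pi_pos
  have hc : Real.cos φ ≤ Real.cos θ := Real.cos_le_cos_of_nonneg_of_le_pi hθ0 h2 h1
  have hc0 : 0 ≤ Real.cos θ := Real.cos_nonneg_of_neg_pi_div_two_le_of_le (by linarith) hθ
  have hn : ‖1 - (x : ℂ) * Complex.exp (φ * Complex.I)‖ ^ 2 =
      (1 - x * Real.cos φ) ^ 2 + (x * Real.sin φ) ^ 2 := by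
    rw [Complex.exp_mul_I, Complex.sq_norm, Complex.normSq_apply, ← Complex.ofReal_cos,
      ← Complex.ofReal_sin]
    simp [-Complex.ofReal_cos, -Complex.ofReal_sin]
    ring
  refine le_of_sq_le_sq ?_ (norm_nonneg _) |> fun h => h
  rw [hn]
  have e1 := Real.sin_sq_add_cos_sq φ
  have e2 := Real.sin_sq_add_cos_sq θ
  have : (1 - x * Real.cos φ) ^ 2 + (x * Real.sin φ) ^ 2 = 1 - 2 * x * Real.cos φ + x ^ 2 := by
    linear_combination x ^ 2 * e1
  rw [this]
  have h5 := mul_le_mul_of_nonneg_left hc hx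
  nlinarith [sq_nonneg (x - Real.cos θ)]

lemma mem_slit {x φ : ℝ} (hx : 0 ≤ x) (h0 : 0 < φ) (h1 : φ ≤ Real.pi) :
    1 - (x : ℂ) * Complex.exp (φ * Complex.I) ∈ Complex.slitPlane := by
  rw [Complex.exp_mul_I, ← Complex.ofReal_cos, ← Complex.ofReal_sin, Complex.mem_slitPlane_iff]
  simp [-Complex.ofReal_cos, -Complex.ofReal_sin]
  rcases h1.lt_or_eq with h | h
  · have := Real.sin_pos_of_pos_of_lt_pi h0 h
    rcases hx.lt_or_eq with h' | h'
    · right; exact ⟨h'.ne', this.ne'⟩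
    · left; rw [← h']; simp
  · left
    rw [h, Real.cos_pi]; linarith

/-- the rectangle argument -/
lemma rect_lemma {ρ θ S C : ℝ} (hθ0 : 0 < θ) (hθ : θ ≤ Real.pi / 2) (hS : 0 ≤ S)
    (N : ℕ) (lam : ℕ → ℝ) (hlam : ∀ k, 0 ≤ lam k)
    (hC : ∀ x y : ℝ, 0 ≤ x → x ≤ S → θ ≤ y → y ≤ Real.pi →
      ∑ k ∈ Finset.range N, ‖Complex.log (1 - ((lam k * Real.exp x : ℝ) : ℂ) *
        Complex.exp (y * Complex.I))‖ ≤ C * Real.exp (ρ * x)) :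
    ∫ x in (0 : ℝ)..S, (∑ k ∈ Finset.range N, Real.log ‖1 - ((lam k * Real.exp x : ℝ) : ℂ) *
        Complex.exp (θ * Complex.I)‖) * Real.exp (-(ρ * x)) ≤
    Real.cos (ρ * (Real.pi - θ)) * (∫ x in (0 : ℝ)..S, (∑ k ∈ Finset.range N,
        Real.log (1 + lam k * Real.exp x)) * Real.exp (-(ρ * x))) + 2 * Real.pi * C := by
  have hpi := Real.pi_pos
  let F : ℂ → ℂ := fun w => (∑ k ∈ Finset.range N, Complex.log (1 - lam k * Complex.exp w)) *
    Complex.exp (-(ρ * (w - θ * Complex.I)))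
  have hexp : ∀ (x y : ℝ) (k : ℕ), (1 : ℂ) - lam k * Complex.exp (x + y * Complex.I) =
      1 - ((lam k * Real.exp x : ℝ) : ℂ) * Complex.exp (y * Complex.I) := by
    intro x y k
    rw [Complex.exp_add]; push_cast; ring
  have hslit : ∀ (x y : ℝ) (k : ℕ), θ ≤ y → y ≤ Real.pi →
      (1 : ℂ) - lam k * Complex.exp (x + y * Complex.I) ∈ Complex.slitPlane := by
    intro x y k h1 h2
    rw [hexp]
    exact mem_slit (mul_nonneg (hlam k) (Real.exp_pos _).le) (by linarith) h2
  have hFd : ∀ (x y : ℝ), θ ≤ y → y ≤ Real.pi → DifferentiableAt ℂ F (x + y * Complex.I) := by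
    intro x y h1 h2
    refine DifferentiableAt.mul ?_ (by fun_prop)
    refine DifferentiableAt.fun_sum fun k _ => ?_
    refine DifferentiableAt.clog (by fun_prop) (hslit x y k h1 h2)
  have hFb : ∀ x y : ℝ, 0 ≤ x → x ≤ S → θ ≤ y → y ≤ Real.pi → ‖F (x + y * Complex.I)‖ ≤ C := by
    intro x y h1 h2 h3 h4
    simp only [F]
    rw [norm_mul, Complex.norm_exp]
    have : (-(ρ * ((x : ℂ) + y * Complex.I - θ * Complex.I))).re = -(ρ * x) := by simp
    rw [this]
    have h5 : ‖∑ k ∈ Finset.range N, Complex.log (1 - lam k * Complex.exp (x + y * Complex.I))‖ ≤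
        C * Real.exp (ρ * x) := by
      refine (norm_sum_le _ _).trans ?_
      simp only [hexp]
      exact hC x y h1 h2 h3 h4
    calc _ ≤ C * Real.exp (ρ * x) * Real.exp (-(ρ * x)) := by gcongr
      _ = C := by rw [mul_assoc, ← Real.exp_add]; simp
  have key := Complex.integral_boundary_rect_eq_zero_of_differentiableOn F (θ * Complex.I)
    (S + Real.pi * Complex.I) (by
      intro w hw
      rw [Complex.mem_reProdIm] at hw
      simp at hw
      rw [Set.uIcc_of_le (show θ ≤ Real.pi by linarith)] at hw
      have := hFd w.re w.im hw.2.1 hw.2.2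
      rw [Complex.re_add_im] at this
      exact this.differentiableWithinAt)
  simp at key
  -- bottom
  have hbot : (∫ x in (0 : ℝ)..S, F (x + θ * Complex.I)).re =
      ∫ x in (0 : ℝ)..S, (∑ k ∈ Finset.range N, Real.log ‖1 - ((lam k * Real.exp x : ℝ) : ℂ) *
        Complex.exp (θ * Complex.I)‖) * Real.exp (-(ρ * x)) := by
    have hint : IntervalIntegrable (fun x : ℝ => F (x + θ * Complex.I)) volume 0 S := by
      refine Continuous.intervalIntegrable ?_ _ _
      refine continuous_iff_continuousAt.2 fun x => ?_
      have := (hFd x θ le_rfl (by linarith)).continuousAt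
      exact ContinuousAt.comp (f := fun x : ℝ => (x : ℂ) + θ * Complex.I) this (by fun_prop)
    have := intervalIntegral.intervalIntegral_re hint
    simp only [RCLike.re_to_complex] at this
    rw [← this]
    congr 1
    ext x
    simp only [F]
    have e : Complex.exp (-(ρ * ((x : ℂ) + θ * Complex.I - θ * Complex.I))) =
        ((Real.exp (-(ρ * x)) : ℝ) : ℂ) := by push_cast; congr 1; ring
    rw [e, Complex.re_mul_ofReal, Complex.re_sum]
    simp only [Complex.log_re, hexp]
  have htop : (∫ x in (0 : ℝ)..S, F (x + Real.pi * Complex.I)).re =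
      Real.cos (ρ * (Real.pi - θ)) * (∫ x in (0 : ℝ)..S, (∑ k ∈ Finset.range N,
        Real.log (1 + lam k * Real.exp x)) * Real.exp (-(ρ * x))) := by
    have : ∀ x : ℝ, F (x + Real.pi * Complex.I) =
        (((∑ k ∈ Finset.range N,
        Real.log (1 + lam k * Real.exp x)) * Real.exp (-(ρ * x)) : ℝ) : ℂ) *
          Complex.exp (-(ρ * (Real.pi - θ) : ℝ) * Complex.I) := by
      intro x
      simp only [F, hexp, Complex.exp_pi_mul_I]
      push_cast
      have e : Complex.exp (-(ρ * ((x : ℂ) + Real.pi * Complex.I - θ * Complex.I))) =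
        Complex.exp (-(ρ * x)) * Complex.exp (-(ρ * (Real.pi - θ)) * Complex.I) := by
        rw [← Complex.exp_add]; congr 1; ring
      rw [e, mul_assoc]
      congr 1
      refine Finset.sum_congr rfl fun k _ => ?_
      have h0 : 0 ≤ 1 + lam k * Real.exp x := by have := hlam k; positivity
      rw [Complex.ofReal_log h0]
      congr 1
      push_cast
      ring
    simp only [this]
    rw [intervalIntegral.integral_mul_const, intervalIntegral.integral_ofReal,
      Complex.re_ofReal_mul, ← Complex.ofReal_neg, Complex.exp_ofReal_mul_I_re, Real.cos_neg,
      mul_comm]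
  have hside : ∀ x : ℝ, 0 ≤ x → x ≤ S →
      ‖∫ y in θ..Real.pi, F (x + y * Complex.I)‖ ≤ C * Real.pi := by
    intro x h1 h2
    have hC0 : 0 ≤ C := (norm_nonneg _).trans (hFb x θ h1 h2 le_rfl (by linarith))
    have := intervalIntegral.norm_integral_le_of_norm_le_const (a := θ) (b := Real.pi) (C := C)
      (f := fun y : ℝ => F (x + y * Complex.I)) (by
        intro y hy
        rw [Set.uIoc_of_le (by linarith)] at hy
        exact hFb x y h1 h2 hy.1.le hy.2)
    refine this.trans ?_
    rw [abs_of_nonneg (by linarith)]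
    gcongr
    linarith
  have hs1 := hside 0 le_rfl hS
  have hs2 := hside S hS le_rfl
  have hre := congrArg Complex.re key
  simp only [Complex.add_re, Complex.sub_re, Complex.mul_re, Complex.I_re, Complex.I_im,
    Complex.zero_re, zero_mul, one_mul, zero_sub] at hre
  rw [hbot, htop] at hre
  simp only [Complex.ofReal_zero, zero_add] at hs1
  have i1 := (Complex.abs_im_le_norm _).trans hs1
  have i2 := (Complex.abs_im_le_norm _).trans hs2
  rw [abs_le] at i1 i2
  linarith [i1.1, i1.2, i2.1, i2.2]

open Filter Topology MeasureTheory

lemma tele_aux {γ : ℝ} (h0 : 0 < γ) (h1 : γ < 1) (j : ℕ) :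
    (j : ℝ) ^ γ ≤ (j + 1 : ℝ) ^ γ * (1 - γ / (j + 1)) := by
  have hj : (0 : ℝ) < j + 1 := by positivity
  have h := rpow_one_add_le_one_add_mul_self (s := -(1 / ((j : ℝ) + 1))) (by
    rw [neg_le_neg_iff, div_le_one hj]; linarith [Nat.cast_nonneg (α := ℝ) j]) h0.le h1.le
  have e : (j : ℝ) = (j + 1) * (1 + -(1 / ((j : ℝ) + 1))) := by field_simp; ring
  have h2 : (0 : ℝ) ≤ 1 + -(1 / ((j : ℝ) + 1)) := by
    have : 1 / ((j : ℝ) + 1) ≤ 1 := by rw [div_le_one hj]; linarith [Nat.cast_nonneg (α := ℝ) j]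
    linarith
  have e2 : (j : ℝ) ^ γ = (j + 1 : ℝ) ^ γ * (1 + -(1 / ((j : ℝ) + 1))) ^ γ := by
    rw [← Real.mul_rpow hj.le h2, ← e]
  rw [e2]
  refine mul_le_mul_of_nonneg_left (h.trans (le_of_eq ?_)) (by positivity)
  ring

lemma tele_one {γ : ℝ} (h0 : 0 < γ) (h1 : γ < 1) (n : ℕ) :
    ∑ j ∈ Finset.range n, (j + 1 : ℝ) ^ (γ - 1) ≤ (n : ℝ) ^ γ / γ := by
  induction n with
  | zero => simp [Real.zero_rpow h0.ne']
  | succ n ih =>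
    rw [Finset.sum_range_succ]
    have h := tele_aux h0 h1 n
    have hj : (0 : ℝ) < n + 1 := by positivity
    have e : (n + 1 : ℝ) ^ (γ - 1) = (n + 1 : ℝ) ^ γ / (n + 1) := by
      rw [Real.rpow_sub hj, Real.rpow_one]
    rw [le_div_iff₀ h0] at *
    push_cast
    rw [e]
    have : (n + 1 : ℝ) ^ γ * (1 - γ / (n + 1)) = (n + 1 : ℝ) ^ γ - (n + 1 : ℝ) ^ γ / (n + 1) * γ := by
      field_simp
    linarith

lemma tele_two {γ : ℝ} (h0 : 0 < γ) (h1 : γ < 1) (n : ℕ) (hn : 1 ≤ n) (N : ℕ) :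
    ∑ i ∈ Finset.range N, ((n + i : ℕ) + 1 : ℝ) ^ (-γ - 1) ≤
      ((n : ℝ) ^ (-γ) - ((n + N : ℕ) : ℝ) ^ (-γ)) / γ := by
  induction N with
  | zero => simp
  | succ N ih =>
    rw [Finset.sum_range_succ]
    have h := tele_aux h0 h1 (n + N)
    set x : ℝ := ((n + N : ℕ) : ℝ) with hx
    have hx1 : 1 ≤ x := by rw [hx]; exact_mod_cast (by omega : 1 ≤ n + N)
    have hj : (0 : ℝ) < x + 1 := by positivity
    have e : (x + 1 : ℝ) ^ (-γ - 1) = (x + 1 : ℝ) ^ (-γ) / (x + 1) := by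
      rw [Real.rpow_sub hj, Real.rpow_one]
    have e2 : (((n + (N + 1) : ℕ)) : ℝ) = x + 1 := by rw [hx]; push_cast; ring
    rw [e2, e]
    rw [le_div_iff₀ h0] at *
    have hp : 0 < (x + 1) ^ γ := by positivity
    have hp2 : 0 < x ^ γ := by positivity
    have key : (x + 1) ^ (-γ) * (1 + γ / (x + 1)) ≤ x ^ (-γ) := by
      rw [Real.rpow_neg hj.le, Real.rpow_neg (by linarith), inv_mul_le_iff₀ hp,
        ← div_eq_mul_inv, le_div_iff₀ hp2]
      have h3 : 0 ≤ 1 + γ / (x + 1) := by positivity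
      calc (1 + γ / (x + 1)) * x ^ γ ≤ (1 + γ / (x + 1)) * ((x + 1) ^ γ * (1 - γ / (x + 1))) :=
            mul_le_mul_of_nonneg_left h h3
        _ = (x + 1) ^ γ * (1 - (γ / (x + 1)) ^ 2) := by ring
        _ ≤ (x + 1) ^ γ * 1 := by gcongr; nlinarith [sq_nonneg (γ / (x + 1))]
        _ = _ := mul_one _
    have : (x + 1 : ℝ) ^ (-γ) * (1 + γ / (x + 1)) = (x + 1 : ℝ) ^ (-γ) + (x + 1 : ℝ) ^ (-γ) / (x + 1) * γ := by
      field_simp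
    linarith

/-- Lemma L -/
lemma sum_min_le {α : ℝ} (h1 : 1 < α) (h2 : α < 2) : ∃ C : ℝ, 0 < C ∧ ∀ (x : ℝ) (u : ℕ → ℝ) (N : ℕ),
    0 ≤ x → (∀ j, u j ≤ (x / (j + 1)) ^ α) → (∀ j, 0 ≤ u j) →
      ∑ j ∈ Finset.range N, min (u j) (√(u j)) ≤ C * x := by
  have g1 : 0 < 1 - α / 2 := by linarith
  have g2 : 0 < α - 1 := by linarith
  have g1' : 1 - α / 2 < 1 := by linarith
  have g2' : α - 1 < 1 := by linarith
  refine ⟨1 / (1 - α / 2) + (1 + 2 / (α - 1)), by positivity, fun x u N hx hu hu0 => ?_⟩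
  have hA : ∀ j : ℕ, min (u j) (√(u j)) ≤ x ^ α * (j + 1 : ℝ) ^ (-(α - 1) - 1) := by
    intro j
    refine (min_le_left _ _).trans ((hu j).trans (le_of_eq ?_))
    rw [Real.div_rpow hx (by positivity), div_eq_mul_inv, ← Real.rpow_neg (by positivity)]
    congr 2; ring
  have hB : ∀ j : ℕ, min (u j) (√(u j)) ≤ x ^ (α / 2) * (j + 1 : ℝ) ^ ((1 - α / 2) - 1) := by
    intro j
    refine (min_le_right _ _).trans ((Real.sqrt_le_sqrt (hu j)).trans (le_of_eq ?_))
    rw [Real.sqrt_eq_rpow, ← Real.rpow_mul (by positivity), Real.div_rpow hx (by positivity),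
      div_eq_mul_inv, ← Real.rpow_neg (by positivity)]
    congr 2 <;> ring
  have hm0 : ∀ j, 0 ≤ min (u j) (√(u j)) := fun j => le_min (hu0 j) (Real.sqrt_nonneg _)
  rcases lt_or_ge x 1 with hx1 | hx1
  · have hS : ∑ j ∈ Finset.range (1 + N), (j + 1 : ℝ) ^ (-(α - 1) - 1) ≤ 1 + 2 / (α - 1) := by
      rw [Finset.sum_range_add]
      have := tele_two g2 g2' 1 le_rfl N
      simp only [Finset.range_one, Finset.sum_singleton, Nat.cast_zero, zero_add, Real.one_rpow]
      have h3 : ((1 : ℕ) : ℝ) ^ (-(α - 1)) = 1 := by simp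
      rw [h3] at this
      have h4 : (1 - ((1 + N : ℕ) : ℝ) ^ (-(α - 1))) / (α - 1) ≤ 2 / (α - 1) := by
        gcongr
        have : 0 ≤ ((1 + N : ℕ) : ℝ) ^ (-(α - 1)) := by positivity
        linarith
      linarith
    have hxa : x ^ α ≤ x := by
      have := Real.rpow_le_rpow_of_exponent_ge' hx hx1.le zero_le_one h1.le
      rwa [Real.rpow_one] at this
    calc ∑ j ∈ Finset.range N, min (u j) (√(u j))
        ≤ ∑ j ∈ Finset.range (1 + N), min (u j) (√(u j)) :=
          Finset.sum_le_sum_of_subset_of_nonneg (by simp) (fun j _ _ => hm0 j)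
      _ ≤ ∑ j ∈ Finset.range (1 + N), x ^ α * (j + 1 : ℝ) ^ (-(α - 1) - 1) :=
          Finset.sum_le_sum fun j _ => hA j
      _ = x ^ α * ∑ j ∈ Finset.range (1 + N), (j + 1 : ℝ) ^ (-(α - 1) - 1) := by
          rw [Finset.mul_sum]
      _ ≤ x * (1 + 2 / (α - 1)) := by gcongr
      _ ≤ _ := by
          have : 0 ≤ 1 / (1 - α / 2) * x := by positivity
          linarith
  · set n := ⌊x⌋₊ with hn
    have hn1 : 1 ≤ n := Nat.one_le_floor_iff x |>.2 hx1
    have hnx : (n : ℝ) ≤ x := Nat.floor_le hx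
    have hxn : x < n + 1 := Nat.lt_floor_add_one x
    have hn1' : (1 : ℝ) ≤ n := by exact_mod_cast hn1
    have hx0 : 0 < x := by linarith
    have hS1 := tele_one g1 g1' n
    have hS2 := tele_two g2 g2' n hn1 N
    have e1 : x ^ (α / 2) * ((n : ℝ) ^ (1 - α / 2) / (1 - α / 2)) ≤ x * (1 / (1 - α / 2)) := by
      calc _ ≤ x ^ (α / 2) * (x ^ (1 - α / 2) / (1 - α / 2)) := by gcongr
        _ = (x ^ (α / 2) * x ^ (1 - α / 2)) * (1 / (1 - α / 2)) := by ring
        _ = _ := by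
          rw [← Real.rpow_add hx0]
          have : α / 2 + (1 - α / 2) = 1 := by ring
          rw [this, Real.rpow_one]
    have e2 : x ^ α * (((n : ℝ) ^ (-(α - 1)) - ((n + N : ℕ) : ℝ) ^ (-(α - 1))) / (α - 1)) ≤
        x * (2 / (α - 1)) := by
      have h3 : (n : ℝ) ^ (-(α - 1)) ≤ 2 * x ^ (-(α - 1)) := by
        have h4 : x ^ (α - 1) ≤ (2 * n : ℝ) ^ (α - 1) := by gcongr; linarith
        have h5 : (2 * n : ℝ) ^ (α - 1) ≤ 2 * (n : ℝ) ^ (α - 1) := by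
          rw [Real.mul_rpow (by norm_num) (by positivity)]
          gcongr
          have := Real.rpow_le_rpow_of_exponent_le (x := 2) (by norm_num) g2'.le
          rwa [Real.rpow_one] at this
        have h6 : 0 < (n : ℝ) ^ (α - 1) := by positivity
        have h7 : 0 < x ^ (α - 1) := by positivity
        rw [Real.rpow_neg (by positivity), Real.rpow_neg hx, ← div_eq_mul_inv, ← one_div,
          div_le_div_iff₀ h6 h7]
        linarith
      have h8 : 0 ≤ ((n + N : ℕ) : ℝ) ^ (-(α - 1)) := by positivity
      calc _ ≤ x ^ α * ((2 * x ^ (-(α - 1))) / (α - 1)) := by gcongr; linarith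
        _ = (x ^ α * x ^ (-(α - 1))) * (2 / (α - 1)) := by ring
        _ = _ := by
          rw [← Real.rpow_add hx0]
          have : α + -(α - 1) = 1 := by ring
          rw [this, Real.rpow_one]
    calc ∑ j ∈ Finset.range N, min (u j) (√(u j))
        ≤ ∑ j ∈ Finset.range (n + N), min (u j) (√(u j)) :=
          Finset.sum_le_sum_of_subset_of_nonneg (by simp) (fun j _ _ => hm0 j)
      _ = ∑ j ∈ Finset.range n, min (u j) (√(u j)) +
          ∑ i ∈ Finset.range N, min (u (n + i)) (√(u (n + i))) := Finset.sum_range_add _ _ _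
      _ ≤ ∑ j ∈ Finset.range n, x ^ (α / 2) * (j + 1 : ℝ) ^ ((1 - α / 2) - 1) +
          ∑ i ∈ Finset.range N, x ^ α * ((n + i : ℕ) + 1 : ℝ) ^ (-(α - 1) - 1) :=
          add_le_add (Finset.sum_le_sum fun j _ => hB j) (Finset.sum_le_sum fun j _ => hA (n + j))
      _ ≤ x * (1 / (1 - α / 2)) + x * (2 / (α - 1)) := by
          rw [← Finset.mul_sum, ← Finset.mul_sum]
          refine add_le_add ((mul_le_mul_of_nonneg_left hS1 (by positivity)).trans e1)
            ((mul_le_mul_of_nonneg_left hS2 (by positivity)).trans e2)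
      _ ≤ _ := by linarith

lemma rpow_small {a b η : ℝ} (hab : a < b) (hη : 0 < η) :
    ∀ᶠ x : ℝ in atTop, x ^ a ≤ η * x ^ b := by
  have h := (tendsto_rpow_neg_atTop (sub_pos.2 hab)).eventually_le_const hη
  filter_upwards [h, eventually_gt_atTop 0] with x h1 hx
  have : x ^ a = x ^ (-(b - a)) * x ^ b := by rw [← Real.rpow_add hx]; congr 1; ring
  rw [this]
  gcongr

open Filter Topology MeasureTheory

lemma le_div_rpow {α M r : ℝ} (h1 : 1 < α) (hM : 0 ≤ M) (hr : 0 ≤ r) (j : ℕ) :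
    r * (M * (j + 1 : ℝ) ^ (-α)) = ((M * r) ^ (1 / α) / (j + 1)) ^ α := by
  rw [Real.div_rpow (by positivity) (by positivity), ← Real.rpow_mul (by positivity),
    one_div_mul_cancel (by linarith), Real.rpow_one, Real.rpow_neg (by positivity)]
  ring

lemma sum_log_le {α : ℝ} (h1 : 1 < α) (h2 : α < 2) : ∃ C : ℝ, 0 < C ∧
    ∀ (M r : ℝ) (s : ℕ → ℝ) (N : ℕ), 0 ≤ M → 0 ≤ r → (∀ j, s j ≤ M * (j + 1 : ℝ) ^ (-α)) →
      (∀ j, 0 ≤ s j) → ∑ j ∈ Finset.range N, Real.log (1 + r * s j) ≤ C * (M * r) ^ (1 / α) := by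
  obtain ⟨C, hC, h⟩ := sum_min_le h1 h2
  refine ⟨2 * C, by positivity, fun M r s N hM hr hs hs0 => ?_⟩
  have := h ((M * r) ^ (1 / α)) (fun j => r * s j) N (by positivity) (fun j => by
    rw [← le_div_rpow h1 hM hr]; exact mul_le_mul_of_nonneg_left (hs j) hr)
    (fun j => mul_nonneg hr (hs0 j))
  calc _ ≤ ∑ j ∈ Finset.range N, 2 * min (r * s j) (√(r * s j)) :=
        Finset.sum_le_sum fun j _ => log_one_add_le_min (mul_nonneg hr (hs0 j))
    _ ≤ _ := by rw [← Finset.mul_sum]; linarith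

lemma kappa_bound {α : ℝ} (h1 : 1 < α) (h2 : α < 2) (k : ℕ → ℝ) (hk0 : ∀ j, 0 ≤ k j)
    (hk : ∀ ε : ℝ, 0 < ε → ∀ᶠ j : ℕ in atTop, k j ≤ ε * (j + 1 : ℝ) ^ (-α)) {η : ℝ} (hη : 0 < η) :
    ∃ C : ℝ, 0 ≤ C ∧ ∀ (r : ℝ) (N : ℕ), 0 ≤ r →
      ∑ j ∈ Finset.range N, Real.log (1 + r * k j) ≤ η * r ^ (1 / α) + C := by
  obtain ⟨CL, hCL, hL⟩ := sum_log_le h1 h2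
  have hα : 0 < α := by linarith
  obtain ⟨n0, hn0⟩ := eventually_atTop.1 (hk ((η / (2 * CL)) ^ α) (by positivity))
  set ε := (η / (2 * CL)) ^ α with hε
  set D := ∑ j ∈ Finset.range n0, 2 * √(k j) with hD
  have hD0 : 0 ≤ D := Finset.sum_nonneg fun j _ => by positivity
  have hρ : 1 / 2 < 1 / α := one_div_lt_one_div_of_lt hα h2
  obtain ⟨r0, hr0⟩ := eventually_atTop.1 (rpow_small hρ (show 0 < η / (2 * (D + 1)) by positivity))
  refine ⟨D * √(max r0 0), by positivity, fun r N hr => ?_⟩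
  have hDr : D * √r ≤ η / 2 * r ^ (1 / α) + D * √(max r0 0) := by
    rcases le_total r0 r with h | h
    · have h3 := hr0 r h
      rw [← Real.sqrt_eq_rpow] at h3
      have h4 : D * √r ≤ D * (η / (2 * (D + 1)) * r ^ (1 / α)) := by gcongr
      have h5 : D * (η / (2 * (D + 1)) * r ^ (1 / α)) ≤ η / 2 * r ^ (1 / α) := by
        rw [← mul_assoc]
        gcongr
        rw [mul_div_assoc', div_le_div_iff₀ (by positivity) (by positivity)]
        nlinarith
      have : 0 ≤ D * √(max r0 0) := by positivity
      linarith
    · have : D * √r ≤ D * √(max r0 0) := by gcongr; exact h.trans (le_max_left _ _)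
      have : 0 ≤ η / 2 * r ^ (1 / α) := by positivity
      linarith
  have hmain := hL ε r (fun j => if j < n0 then 0 else k j) N (by positivity) hr (by
    intro j; split_ifs with h
    · positivity
    · exact hn0 j (by omega)) (by intro j; split_ifs; exacts [le_rfl, hk0 j])
  have e : CL * (ε * r) ^ (1 / α) = η / 2 * r ^ (1 / α) := by
    rw [Real.mul_rpow (by positivity) hr, hε, ← Real.rpow_mul (by positivity),
      mul_one_div_cancel hα.ne', Real.rpow_one]
    field_simp
  rw [e] at hmain
  have hle : ∀ j, Real.log (1 + r * k j) ≤ Real.log (1 + r * (if j < n0 then 0 else k j)) +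
      (if j < n0 then 2 * √(k j) * √r else 0) := by
    intro j
    split_ifs with h
    · have := (log_one_add_le_min (mul_nonneg hr (hk0 j)))
      have h4 := min_le_right (r * k j) (√(r * k j))
      rw [Real.sqrt_mul hr] at h4 this
      simp
      nlinarith
    · simp
  have hlast : ∑ j ∈ Finset.range N, (if j < n0 then 2 * √(k j) * √r else 0) ≤ D * √r := by
    rw [hD, Finset.sum_mul, ← Finset.sum_filter]
    refine Finset.sum_le_sum_of_subset_of_nonneg ?_ (fun j _ _ => by positivity)
    intro j; simp
  calc _ ≤ _ := Finset.sum_le_sum fun j _ => hle j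
    _ ≤ _ := by rw [Finset.sum_add_distrib]; linarith

lemma sNum_dec_index {H : Type*} [NormedAddCommGroup H] [InnerProductSpace ℂ H]
    (T : H →L[ℂ] H) (i : ℕ) : sNum T (i + 1) ≤ sNum T (i / 2 + i / 2 + 1) :=
  sNum_anti T (by omega) (by omega)

lemma half_pow {α : ℝ} (hα : 0 < α) (i : ℕ) :
    (((i / 2 : ℕ) : ℝ) + 1) ^ (-α) ≤ 2 ^ α * (i + 1 : ℝ) ^ (-α) := by
  have h1 : (i + 1 : ℝ) / 2 ≤ ((i / 2 : ℕ) : ℝ) + 1 := by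
    have : i + 1 ≤ 2 * (i / 2 + 1) := by omega
    have : ((i + 1 : ℕ) : ℝ) ≤ ((2 * (i / 2 + 1) : ℕ) : ℝ) := by exact_mod_cast this
    push_cast at this
    linarith
  have h2 := Real.rpow_le_rpow_of_nonpos (by positivity) h1 (by linarith : -α ≤ 0)
  refine h2.trans (le_of_eq ?_)
  rw [Real.div_rpow (by positivity) (by norm_num), Real.rpow_neg (by norm_num : (0:ℝ) ≤ 2)]
  field_simp

section
variable {H : Type*} [NormedAddCommGroup H] [InnerProductSpace ℂ H]

lemma dec_add {S T : H →L[ℂ] H} {α M M' : ℝ} (hα : 0 < α)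
    (hS : ∀ j : ℕ, sNum S (j + 1) ≤ M * (j + 1 : ℝ) ^ (-α))
    (hT : ∀ j : ℕ, sNum T (j + 1) ≤ M' * (j + 1 : ℝ) ^ (-α)) (hM : 0 ≤ M) (hM' : 0 ≤ M') :
    ∀ j : ℕ, sNum (S + T) (j + 1) ≤ (M + M') * 2 ^ α * (j + 1 : ℝ) ^ (-α) := by
  intro j
  refine (sNum_dec_index _ j).trans ((sNum_add_le S T _ _).trans ?_)
  have := half_pow hα j
  calc _ ≤ M * ((j / 2 : ℕ) + 1 : ℝ) ^ (-α) + M' * ((j / 2 : ℕ) + 1 : ℝ) ^ (-α) :=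
        add_le_add (hS _) (hT _)
    _ = (M + M') * ((j / 2 : ℕ) + 1 : ℝ) ^ (-α) := by ring
    _ ≤ (M + M') * (2 ^ α * (j + 1 : ℝ) ^ (-α)) := by gcongr
    _ = _ := by ring

lemma bdd_of_little {k : ℕ → ℝ} {α : ℝ}
    (hk : ∀ ε : ℝ, 0 < ε → ∀ᶠ j : ℕ in atTop, k j ≤ ε * (j + 1 : ℝ) ^ (-α)) :
    ∃ M : ℝ, 0 ≤ M ∧ ∀ j : ℕ, k j ≤ M * (j + 1 : ℝ) ^ (-α) := by
  obtain ⟨n, hn⟩ := eventually_atTop.1 (hk 1 one_pos)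
  have hpos : ∀ j : ℕ, 0 < (j + 1 : ℝ) ^ (-α) := fun j => by positivity
  refine ⟨1 + ∑ j ∈ Finset.range n, |k j| / (j + 1 : ℝ) ^ (-α), ?_, fun j => ?_⟩
  · have : 0 ≤ ∑ j ∈ Finset.range n, |k j| / (j + 1 : ℝ) ^ (-α) :=
      Finset.sum_nonneg fun j _ => div_nonneg (abs_nonneg _) (hpos j).le
    linarith
  · have h0 : 0 ≤ ∑ j ∈ Finset.range n, |k j| / (j + 1 : ℝ) ^ (-α) :=
      Finset.sum_nonneg fun j _ => div_nonneg (abs_nonneg _) (hpos j).le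
    rcases lt_or_ge j n with h | h
    · have h1 : |k j| / (j + 1 : ℝ) ^ (-α) ≤ ∑ j ∈ Finset.range n, |k j| / (j + 1 : ℝ) ^ (-α) :=
        Finset.single_le_sum (f := fun j : ℕ => |k j| / (j + 1 : ℝ) ^ (-α))
          (fun j _ => div_nonneg (abs_nonneg _) (hpos j).le) (Finset.mem_range.2 h)
      rw [div_le_iff₀ (hpos j)] at h1
      have := le_abs_self (k j)
      have := hpos j
      nlinarith
    · have := hn j h
      have := hpos j
      nlinarith

lemma tendsto_of_dec {T : H →L[ℂ] H} {α M : ℝ} (hα : 0 < α)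
    (hT : ∀ j : ℕ, sNum T (j + 1) ≤ M * (j + 1 : ℝ) ^ (-α)) :
    Tendsto (fun n => sNum T n) atTop (𝓝 0) := by
  rw [← tendsto_add_atTop_iff_nat 1]
  refine squeeze_zero (fun n => sNum_nonneg _ _) hT ?_
  have h1 := (tendsto_rpow_neg_atTop hα).comp
    (tendsto_atTop_add_const_right atTop (1 : ℝ) tendsto_natCast_atTop_atTop)
  have := h1.const_mul M
  rw [mul_zero] at this
  exact this
end

open Filter Topology MeasureTheory

section
variable {H : Type*} [NormedAddCommGroup H] [InnerProductSpace ℂ H] [CompleteSpace H]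

set_option maxHeartbeats 4000000 in
theorem core_contra {B K : H →L[ℂ] H} (hB : B.IsPositive) {α M c : ℝ} (h1 : 1 < α) (h2 : α < 2)
    (hM : 0 < M) (hc : 0 < c)
    (hBu : ∀ j : ℕ, sNum B (j + 1) ≤ M * (j + 1 : ℝ) ^ (-α))
    (hBl : ∀ᶠ j : ℕ in atTop, c * (j + 1 : ℝ) ^ (-α) ≤ sNum B (j + 1))
    (hK : ∀ ε : ℝ, 0 < ε → ∀ᶠ j : ℕ in atTop, sNum K (j + 1) ≤ ε * (j + 1 : ℝ) ^ (-α))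
    (hA : ∀ z : ℂ, IsUnit (1 - z • (B + K))) : False := by
  have hα : 0 < α := by linarith
  have hpi := Real.pi_pos
  obtain ⟨MK, hMK, hKu⟩ := bdd_of_little hK
  have hAu := dec_add hα hBu hKu hM.le hMK
  obtain ⟨MA, hMAdef⟩ : ∃ MA, MA = (M + MK) * 2 ^ α := ⟨_, rfl⟩
  have hMA : 0 ≤ MA := by rw [hMAdef]; positivity
  rw [← hMAdef] at hAu
  obtain ⟨CL, hCL, hL⟩ := sum_log_le h1 h2
  obtain ⟨CL', hCL', hL'⟩ := sum_min_le h1 h2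
  obtain ⟨ρ, hρ⟩ : ∃ ρ, ρ = 1 / α := ⟨_, rfl⟩
  have hρ0 : 0 < ρ := by rw [hρ]; positivity
  have hρ1 : ρ < 1 := by rw [hρ, div_lt_one hα]; exact h1
  have hρα : ρ * α = 1 := by rw [hρ]; field_simp
  rw [← hρ] at hL
  obtain ⟨θ, hθ⟩ : ∃ θ, θ = Real.pi * (1 - α / 2) / 2 := ⟨_, rfl⟩
  have hθ0 : 0 < θ := by
    rw [hθ]; have : 0 < 1 - α / 2 := by linarith
    positivity
  have hθ1 : θ ≤ Real.pi / 2 := by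
    rw [hθ]; nlinarith
  have hsin : 0 < Real.sin θ := Real.sin_pos_of_pos_of_lt_pi hθ0 (by linarith)
  obtain ⟨δ, hδ⟩ : ∃ δ, δ = Real.sin θ := ⟨_, rfl⟩
  rw [← hδ] at hsin
  obtain ⟨c0, hc0def⟩ : ∃ c0, c0 = -Real.cos (ρ * (Real.pi - θ)) := ⟨_, rfl⟩
  have hc0 : 0 < c0 := by
    have e : ρ * (Real.pi - θ) = Real.pi / 2 * ρ + Real.pi / 4 := by
      rw [hθ]; linear_combination (Real.pi / 4) * hρα
    have hρ2 : 1 / 2 < ρ := by rw [hρ]; exact one_div_lt_one_div_of_lt hα h2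
    rw [hc0def, neg_pos]
    refine Real.cos_neg_of_pi_div_two_lt_of_lt ?_ ?_ <;> rw [e] <;> nlinarith
  obtain ⟨Clog, hClog, hlog⟩ := norm_log_bound hsin
  obtain ⟨C', hC'⟩ : ∃ C', C' = Clog * (CL' * M ^ ρ) := ⟨_, rfl⟩
  obtain ⟨J0, hJ0⟩ := eventually_atTop.1 hBl
  obtain ⟨c1, hc1def⟩ : ∃ c1, c1 = Real.log (1 + c / 2) := ⟨_, rfl⟩
  have hc1 : 0 < c1 := by rw [hc1def]; exact Real.log_pos (by linarith)
  have hKδ : ∀ ε : ℝ, 0 < ε → ∀ᶠ j : ℕ in atTop, sNum K (j + 1) / δ ≤ ε * (j + 1 : ℝ) ^ (-α) := by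
    intro ε hε
    filter_upwards [hK (ε * δ) (by positivity)] with j hj
    rw [div_le_iff₀ hsin]
    linarith
  obtain ⟨Cκ, hCκ, hκ⟩ := kappa_bound h1 h2 (fun j => sNum K (j + 1) / δ)
    (fun j => div_nonneg (sNum_nonneg _ _) hsin.le) hKδ (show 0 < c0 * c1 / 2 by positivity)
  rw [← hρ] at hκ
  -- choose S
  obtain ⟨S, hS⟩ : ∃ S : ℝ, S = ((1 + Cκ + c0 * (c1 * (1 + J0))) / ρ + 2 * Real.pi * C' + 1) /
    (c0 * c1 / 2) := ⟨_, rfl⟩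
  have hC'0 : 0 ≤ C' := by rw [hC']; positivity
  have hS0 : 0 ≤ S := by rw [hS]; positivity
  have hSeq : c0 * c1 / 2 * S = (1 + Cκ + c0 * (c1 * (1 + J0))) / ρ + 2 * Real.pi * C' + 1 := by
    rw [hS]; field_simp
  obtain ⟨E, hE⟩ : ∃ E, E = Real.exp S := ⟨_, rfl⟩
  have hE0 : 0 < E := by rw [hE]; exact Real.exp_pos _
  obtain ⟨CA, hCA⟩ : ∃ CA, CA = CL * MA ^ ρ := ⟨_, rfl⟩
  have hCA0 : 0 ≤ CA := by rw [hCA]; positivity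
  -- choose R
  obtain ⟨R, hR1, hR2⟩ := ((rpow_small hρ1 (show 0 < 1 / (4 * E * CA + 1) by positivity)).and
    (eventually_ge_atTop (6 * E))).exists
  rw [Real.rpow_one] at hR1
  have hR0 : 0 < R := by linarith
  have hRR : 2 * (CA * R ^ ρ + 1) * E ≤ R - E := by
    have : 4 * E * CA * R ^ ρ ≤ R := by
      calc 4 * E * CA * R ^ ρ ≤ 4 * E * CA * (1 / (4 * E * CA + 1) * R) := by gcongr
        _ = (4 * E * CA) / (4 * E * CA + 1) * R := by ring
        _ ≤ 1 * R := by
          gcongr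
          rw [div_le_one (by positivity)]; linarith
        _ = R := one_mul _
    linarith
  -- choose ε
  obtain ⟨n, hn⟩ : ∃ n : ℕ, n = ⌈Real.exp (ρ * S)⌉₊ := ⟨_, rfl⟩
  have hnpos : (0 : ℝ) < n := by
    rw [hn]; exact_mod_cast Nat.ceil_pos.2 (Real.exp_pos _)
  obtain ⟨N, lam, p, hlam, hp, hp0, hpne, hlamu, hlaml, hpd, hpA⟩ :=
    exists_data hB (tendsto_of_dec hα hBu) (tendsto_of_dec hα hAu) hA hR0.le
      (show 0 < c / 2 * (n : ℝ) ^ (-α) by positivity)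
  -- growth of p
  have hpb : ∀ z : ℂ, ‖z‖ ≤ R → ‖p z‖ ≤ Real.exp (CA * R ^ ρ + 1) := by
    intro z hz
    refine (hpA z).trans ?_
    have hpos : ∀ i ∈ Finset.range N, 0 < 1 + ‖z‖ * sNum (B + K) (i + 1) := fun i _ => by
      have := sNum_nonneg (B + K) (i + 1); positivity
    have := hL MA ‖z‖ (fun j => sNum (B + K) (j + 1)) N hMA (norm_nonneg _) hAu
      (fun j => sNum_nonneg _ _)
    rw [← Real.exp_log (Finset.prod_pos hpos), Real.exp_le_exp,
      Real.log_prod (fun i hi => (hpos i hi).ne')]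
    refine this.trans ?_
    rw [Real.mul_rpow hMA (norm_nonneg _), ← mul_assoc, ← hCA]
    have : CA * ‖z‖ ^ ρ ≤ CA * R ^ ρ := by gcongr
    linarith
  have hpl : ∀ z : ℂ, ‖z‖ ≤ E → Real.exp (-1) ≤ ‖p z‖ := by
    intro z hz
    have := log_ball_bound hp hp0 hR0 (show 0 < CA * R ^ ρ + 1 by positivity) hpne hpb
      (z := z) (by linarith)
    refine le_trans ?_ this
    rw [Real.exp_le_exp, neg_le_neg_iff, div_le_one (by linarith)]
    have : 2 * (CA * R ^ ρ + 1) * ‖z‖ ≤ 2 * (CA * R ^ ρ + 1) * E := by gcongr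
    linarith
  -- pointwise inequality
  have hlow : ∀ (x y : ℝ) (k : ℕ), θ ≤ y → y ≤ Real.pi →
      δ ≤ ‖1 - ((lam k * Real.exp x : ℝ) : ℂ) * Complex.exp (y * Complex.I)‖ := by
    intro x y k hy1 hy2
    rw [hδ]
    exact norm_one_sub_ge hθ0.le hθ1 hy1 hy2 (mul_nonneg (hlam k) (Real.exp_pos _).le)
  have hpt : ∀ x : ℝ, x ∈ Set.Icc 0 S → -(c0 * c1 / 2) - (1 + Cκ) * Real.exp (-(ρ * x)) ≤
      (∑ k ∈ Finset.range N, Real.log ‖1 - ((lam k * Real.exp x : ℝ) : ℂ) *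
        Complex.exp (θ * Complex.I)‖) * Real.exp (-(ρ * x)) := by
    intro x hx
    have hz : ‖(Real.exp x : ℂ) * Complex.exp (θ * Complex.I)‖ = Real.exp x := by
      rw [norm_mul, Complex.norm_exp_ofReal_mul_I, mul_one, Complex.norm_real, Real.norm_eq_abs,
        abs_of_pos (Real.exp_pos x)]
    have a1 := hpl ((Real.exp x : ℂ) * Complex.exp (θ * Complex.I)) (by
      rw [hz, hE, Real.exp_le_exp]; exact hx.2)
    have a2 := hpd ((Real.exp x : ℂ) * Complex.exp (θ * Complex.I))
      (fun k => ‖1 - ((lam k * Real.exp x : ℝ) : ℂ) * Complex.exp (θ * Complex.I)‖) δ hsin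
      (fun k => hlow x θ k le_rfl (by linarith)) (fun k => le_of_eq (by
        congr 2; push_cast; ring))
    rw [hz] at a2
    have a3 := a1.trans a2
    have q1 : ∀ k ∈ Finset.range N,
        0 < ‖1 - ((lam k * Real.exp x : ℝ) : ℂ) * Complex.exp (θ * Complex.I)‖ := fun k _ =>
      hsin.trans_le (hlow x θ k le_rfl (by linarith))
    have q2 : ∀ i ∈ Finset.range N, 0 < 1 + Real.exp x / δ * sNum K (i + 1) := fun i _ => by
      have := sNum_nonneg K (i + 1); positivity
    have a4 := Real.log_le_log (Real.exp_pos _) a3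
    rw [Real.log_exp, Real.log_mul (Finset.prod_pos q1).ne' (Finset.prod_pos q2).ne',
      Real.log_prod (fun i hi => (q1 i hi).ne'), Real.log_prod (fun i hi => (q2 i hi).ne')] at a4
    have a5 := hκ (Real.exp x) N (Real.exp_pos x).le
    have e1 : ∀ i, Real.exp x / δ * sNum K (i + 1) = Real.exp x * (sNum K (i + 1) / δ) := by
      intro i; ring
    simp only [e1] at a4
    rw [← Real.exp_mul, mul_comm x ρ] at a5
    have hh : Real.exp (ρ * x) * Real.exp (-(ρ * x)) = 1 := by rw [← Real.exp_add]; simp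
    have hh0 := Real.exp_pos (-(ρ * x))
    have a6 : -(c0 * c1 / 2) * Real.exp (ρ * x) - (1 + Cκ) ≤
      ∑ k ∈ Finset.range N, Real.log ‖1 - ((lam k * Real.exp x : ℝ) : ℂ) *
        Complex.exp (θ * Complex.I)‖ := by linarith
    have a7 := mul_le_mul_of_nonneg_right a6 hh0.le
    refine le_trans (le_of_eq ?_) a7
    linear_combination (c0 * c1 / 2) * hh
  -- lower bound of L
  have hLl : ∀ x : ℝ, x ∈ Set.Icc 0 S → c1 - c1 * (1 + J0) * Real.exp (-(ρ * x)) ≤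
      (∑ k ∈ Finset.range N, Real.log (1 + lam k * Real.exp x)) * Real.exp (-(ρ * x)) := by
    intro x hx
    have hh : Real.exp (ρ * x) * Real.exp (-(ρ * x)) = 1 := by rw [← Real.exp_add]; simp
    have hh0 := Real.exp_pos (-(ρ * x))
    have hnn : ∀ k, 0 ≤ Real.log (1 + lam k * Real.exp x) := fun k =>
      Real.log_nonneg (by have := hlam k; have := Real.exp_pos x; nlinarith)
    have hkey : ∀ j ∈ Finset.Ico J0 ⌊Real.exp (ρ * x)⌋₊, j ∈ Finset.range N ∧
        c1 ≤ Real.log (1 + lam j * Real.exp x) := by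
      intro j hj
      rw [Finset.mem_Ico] at hj
      have hj1 : (j + 1 : ℝ) ≤ Real.exp (ρ * x) := by
        have := (Nat.le_floor_iff (Real.exp_pos (ρ * x)).le).1 (Nat.succ_le_of_lt hj.2)
        push_cast at this; exact this
      have hjn : (j + 1 : ℝ) ≤ n := by
        refine hj1.trans ?_
        rw [hn]
        refine le_trans ?_ (Nat.le_ceil _)
        rw [Real.exp_le_exp]
        exact mul_le_mul_of_nonneg_left hx.2 hρ0.le
      have hb := hJ0 j hj.1
      have hpow : (n : ℝ) ^ (-α) ≤ (j + 1 : ℝ) ^ (-α) :=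
        Real.rpow_le_rpow_of_nonpos (by positivity) hjn (by linarith)
      have hjp : 0 < (j + 1 : ℝ) ^ (-α) := by positivity
      have hcc : c / 2 * (n : ℝ) ^ (-α) ≤ c / 2 * (j + 1 : ℝ) ^ (-α) := by gcongr
      have hcp : 0 < c * (j + 1 : ℝ) ^ (-α) := by positivity
      obtain ⟨hjN, hl⟩ := hlaml j (by linarith)
      refine ⟨Finset.mem_range.2 hjN, ?_⟩
      rw [hc1def]
      refine Real.log_le_log (by positivity) ?_
      have hl2 : c / 2 * (j + 1 : ℝ) ^ (-α) ≤ lam j := by linarith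
      have hx1 : 1 ≤ (j + 1 : ℝ) ^ (-α) * Real.exp x := by
        have e : Real.exp x = (Real.exp (ρ * x)) ^ α := by
          rw [← Real.exp_mul]; congr 1; linear_combination (-x) * hρα
        rw [e, Real.rpow_neg (by positivity), inv_mul_eq_div, one_le_div (by positivity)]
        gcongr
      have : c / 2 * 1 ≤ c / 2 * ((j + 1 : ℝ) ^ (-α) * Real.exp x) := by gcongr
      have h5 := mul_le_mul_of_nonneg_right hl2 (Real.exp_pos x).le
      linarith
    have hsum : (Real.exp (ρ * x) - 1 - J0) * c1 ≤
        ∑ k ∈ Finset.range N, Real.log (1 + lam k * Real.exp x) := by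
      calc (Real.exp (ρ * x) - 1 - J0) * c1
          ≤ ((Finset.Ico J0 ⌊Real.exp (ρ * x)⌋₊).card : ℝ) * c1 := by
            gcongr
            rw [Nat.card_Ico]
            have h3 := Nat.lt_floor_add_one (Real.exp (ρ * x))
            have h4 : ((⌊Real.exp (ρ * x)⌋₊ : ℕ) : ℝ) ≤
              ((⌊Real.exp (ρ * x)⌋₊ - J0 : ℕ) : ℝ) + J0 := by
              exact_mod_cast (by omega)
            linarith
        _ = ∑ k ∈ Finset.Ico J0 ⌊Real.exp (ρ * x)⌋₊, c1 := by rw [Finset.sum_const, nsmul_eq_mul]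
        _ ≤ ∑ k ∈ Finset.Ico J0 ⌊Real.exp (ρ * x)⌋₊, Real.log (1 + lam k * Real.exp x) :=
            Finset.sum_le_sum fun k hk => (hkey k hk).2
        _ ≤ _ := Finset.sum_le_sum_of_subset_of_nonneg (fun k hk => (hkey k hk).1)
            (fun k _ _ => hnn k)
    refine le_trans (le_of_eq ?_) (mul_le_mul_of_nonneg_right hsum hh0.le)
    linear_combination (-c1) * hh
  -- rectangle
  have hrect := rect_lemma (ρ := ρ) (C := C') hθ0 hθ1 hS0 N lam hlam (by
    intro x y hx0 hxS hy1 hy2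
    have b1 := hL' ((M * Real.exp x) ^ (1 / α)) (fun k => Real.exp x * lam k) N (by positivity)
      (fun j => by
        rw [← le_div_rpow h1 hM.le (Real.exp_pos x).le]
        exact mul_le_mul_of_nonneg_left ((hlamu j).trans (hBu j)) (Real.exp_pos x).le)
      (fun j => mul_nonneg (Real.exp_pos x).le (hlam j))
    rw [← hρ, Real.mul_rpow hM.le (Real.exp_pos x).le, ← Real.exp_mul, mul_comm x ρ] at b1
    have b2 : ∀ k ∈ Finset.range N, ‖Complex.log (1 - ((lam k * Real.exp x : ℝ) : ℂ) *
        Complex.exp (y * Complex.I))‖ ≤ Clog * min (Real.exp x * lam k) (√(Real.exp x * lam k)) := by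
      intro k _
      have := hlog _ (hlow x y k hy1 hy2)
      rw [norm_mul, Complex.norm_exp_ofReal_mul_I, mul_one, Complex.norm_real, Real.norm_eq_abs,
        abs_of_nonneg (mul_nonneg (hlam k) (Real.exp_pos x).le), mul_comm (lam k)] at this
      rwa [mul_comm (lam k)]
    refine (Finset.sum_le_sum b2).trans ?_
    rw [← Finset.mul_sum, hC']
    calc _ ≤ Clog * (CL' * (M ^ ρ * Real.exp (ρ * x))) := by gcongr
      _ = _ := by ring)
  -- integrate
  have hI : ∫ x in (0 : ℝ)..S, Real.exp (-(ρ * x)) ≤ 1 / ρ := by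
    have e : ∀ x : ℝ, -(ρ * x) = (-ρ) * x := fun x => by ring
    simp only [e]
    rw [intervalIntegral.integral_comp_mul_left (fun x => Real.exp x) (by linarith : -ρ ≠ 0),
      integral_exp, smul_eq_mul, mul_zero, Real.exp_zero, inv_neg, one_div]
    have := Real.exp_pos (-ρ * S)
    have := inv_pos.2 hρ0
    nlinarith
  have hhint : IntervalIntegrable (fun x : ℝ => Real.exp (-(ρ * x))) volume 0 S :=
    Continuous.intervalIntegrable (by fun_prop) _ _
  have I1 := intervalIntegral.integral_mono_on (μ := volume) hS0
    (f := fun x => -(c0 * c1 / 2) - (1 + Cκ) * Real.exp (-(ρ * x)))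
    (Continuous.intervalIntegrable (by fun_prop) _ _)
    (Continuous.intervalIntegrable (by
      refine Continuous.mul ?_ (by fun_prop)
      refine continuous_finsetSum _ fun k _ => ?_
      refine Continuous.log (by fun_prop) fun x => ?_
      exact (hsin.trans_le (hlow x θ k le_rfl (by linarith))).ne') _ _) hpt
  have I2 := intervalIntegral.integral_mono_on (μ := volume) hS0
    (f := fun x => c1 - c1 * (1 + J0) * Real.exp (-(ρ * x)))
    (Continuous.intervalIntegrable (by fun_prop) _ _)
    (Continuous.intervalIntegrable (by
      refine Continuous.mul ?_ (by fun_prop)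
      refine continuous_finsetSum _ fun k _ => ?_
      refine Continuous.log (by fun_prop) fun x => ?_
      have := hlam k
      positivity) _ _) hLl
  rw [intervalIntegral.integral_sub (by simp) (hhint.const_mul _),
    intervalIntegral.integral_const_mul, intervalIntegral.integral_const, smul_eq_mul, sub_zero]
    at I1 I2
  have hcos : Real.cos (ρ * (Real.pi - θ)) = -c0 := by rw [hc0def]; ring
  rw [hcos] at hrect
  have I3 := mul_le_mul_of_nonneg_left I2 hc0.le
  have I4 : (1 + Cκ + c0 * (c1 * (1 + J0))) * (∫ x in (0 : ℝ)..S, Real.exp (-(ρ * x))) ≤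
      (1 + Cκ + c0 * (c1 * (1 + J0))) * (1 / ρ) := mul_le_mul_of_nonneg_left hI (by positivity)
  rw [mul_one_div] at I4
  linarith
end

open Filter Topology MeasureTheory

lemma primary_bound (w : ℂ) : max (1 / 2) ‖1 - w‖ * Real.exp w.re ≤ Real.exp (3 * (‖w‖ * √‖w‖)) := by
  have hn := norm_nonneg w
  have hsq := Real.sq_sqrt hn
  have hsn := Real.sqrt_nonneg ‖w‖
  rcases le_total ‖w‖ (1 / 2) with h | h
  · have h1 : 1 / 2 ≤ ‖1 - w‖ := by
      have := norm_sub_norm_le (1 : ℂ) w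
      rw [norm_one] at this
      linarith
    rw [max_eq_right h1]
    have hne : (1 - w) ≠ 0 := fun h0 => by rw [h0, norm_zero] at h1; linarith
    have e : ‖1 - w‖ * Real.exp w.re = Real.exp ((Complex.log (1 - w) + w).re) := by
      rw [← Complex.norm_exp, ← Complex.norm_exp, Complex.exp_add, Complex.exp_log hne, norm_mul]
    rw [e, Real.exp_le_exp]
    have h2 := Complex.norm_log_one_add_sub_self_le (z := -w) (by rw [norm_neg]; linarith)
    rw [norm_neg, ← sub_eq_add_neg, sub_neg_eq_add] at h2
    refine (Complex.re_le_norm _).trans (h2.trans ?_)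
    have h3 : (1 - ‖w‖)⁻¹ ≤ 2 := by
      rw [inv_le_comm₀ (by linarith) (by norm_num)]; linarith
    have h4 : ‖w‖ ≤ √‖w‖ := Real.le_sqrt_of_sq_le (by nlinarith)
    have h5 : ‖w‖ ^ 2 * (1 - ‖w‖)⁻¹ ≤ ‖w‖ ^ 2 * 2 := by gcongr
    nlinarith [mul_le_mul_of_nonneg_left h4 hn, mul_nonneg hn hsn]
  · have h1 : max (1 / 2) ‖1 - w‖ ≤ Real.exp ‖w‖ := by
      have h2 := Real.add_one_le_exp ‖w‖
      refine max_le (by linarith) ?_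
      refine (norm_sub_le _ _).trans ?_
      rw [norm_one]; linarith
    have h2 : Real.exp w.re ≤ Real.exp ‖w‖ := Real.exp_le_exp.2 (Complex.re_le_norm _)
    calc _ ≤ Real.exp ‖w‖ * Real.exp ‖w‖ := by gcongr
      _ = Real.exp (‖w‖ + ‖w‖) := (Real.exp_add _ _).symm
      _ ≤ _ := by
        rw [Real.exp_le_exp]
        have h3 : 2 / 3 ≤ √‖w‖ := Real.le_sqrt_of_sq_le (by nlinarith)
        nlinarith

section
variable {H : Type*} [NormedAddCommGroup H] [InnerProductSpace ℂ H] [CompleteSpace H]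

set_option maxHeartbeats 4000000 in
theorem one_contra {B K : H →L[ℂ] H} (hB : B.IsPositive)
    (hBs : Tendsto (fun n => sNum B n) atTop (𝓝 0))
    (hAs : Tendsto (fun n => sNum (B + K) n) atTop (𝓝 0))
    (hB32 : Summable fun j : ℕ => sNum B (j + 1) * √(sNum B (j + 1)))
    (hB1 : ¬ Summable fun j : ℕ => sNum B (j + 1))
    (hK : Summable fun j : ℕ => sNum K (j + 1))
    (hA : ∀ z : ℂ, IsUnit (1 - z • (B + K))) : False := by
  obtain ⟨Q, hQ⟩ : ∃ Q, Q = ∑' j : ℕ, sNum B (j + 1) * √(sNum B (j + 1)) := ⟨_, rfl⟩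
  have hQ0 : 0 ≤ Q := by
    rw [hQ]; exact tsum_nonneg fun j => mul_nonneg (sNum_nonneg _ _) (Real.sqrt_nonneg _)
  obtain ⟨Sk, hSk⟩ : ∃ Sk, Sk = ∑' j : ℕ, sNum K (j + 1) := ⟨_, rfl⟩
  have hSk0 : 0 ≤ Sk := by rw [hSk]; exact tsum_nonneg fun j => sNum_nonneg _ _
  obtain ⟨G, hG⟩ : ∃ G : ℝ → ℝ, G = fun x => 3 * (Q * (x * √x)) + 2 * x * Sk + 1 := ⟨_, rfl⟩
  have hG0 : ∀ x, 0 ≤ x → 0 < G x := fun x hx => by rw [hG]; positivity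
  have hGm : ∀ x y, 0 ≤ x → x ≤ y → G x ≤ G y := fun x y hx hxy => by
    rw [hG]; dsimp only; have : 0 ≤ y := hx.trans hxy; gcongr
  apply hB1
  refine summable_of_sum_range_le (c := 2 * (2 * G 2 + 1 + Sk) + 2) (fun j => sNum_nonneg _ _) ?_
  intro n
  obtain ⟨r, hr⟩ : ∃ r : ℝ, r = 4 * n + 1 := ⟨_, rfl⟩
  have hr0 : 0 < r := by rw [hr]; positivity
  obtain ⟨D, hD⟩ : ∃ D, D = 3 * Q + 2 * Sk + 1 := ⟨_, rfl⟩
  have hD0 : 0 < D := by rw [hD]; positivity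
  obtain ⟨R, hR⟩ : ∃ R, R = (16 * D * r) ^ 2 + 2 * r + 2 := ⟨_, rfl⟩
  have hR2 : 2 ≤ R := by rw [hR]; have : 0 ≤ (16 * D * r) ^ 2 := by positivity
                         linarith
  have hRr : r < R / 2 := by
    have : 0 ≤ (16 * D * r) ^ 2 := by positivity
    linarith
  have hRs : 16 * D * r ≤ √R := Real.le_sqrt_of_sq_le (by rw [hR]; linarith)
  have hR0 : 0 < R := by linarith
  have hGR : 16 * G R / R ^ 2 * r ≤ 1 := by
    rw [div_mul_eq_mul_div, div_le_one (by positivity)]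
    have h1 : 1 ≤ √R := Real.le_sqrt_of_sq_le (by linarith)
    have h2 : G R ≤ D * (R * √R) := by
      rw [hG, hD]; dsimp only
      have h3 : R ≤ R * √R := le_mul_of_one_le_right hR0.le h1
      have h4 : R * Sk ≤ R * √R * Sk := mul_le_mul_of_nonneg_right h3 hSk0
      linarith
    have hss := Real.mul_self_sqrt hR0.le
    calc 16 * G R * r ≤ 16 * (D * (R * √R)) * r := by gcongr
      _ = (16 * D * r) * (R * √R) := by ring
      _ ≤ √R * (R * √R) := by gcongr
      _ = R * (√R * √R) := by ring
      _ = R ^ 2 := by rw [hss]; ring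
  obtain ⟨N, lam, p, hlam, hp, hp0, hpne, hlamu, hlaml, hpd, -⟩ :=
    exists_data hB hBs hAs hA hR0.le (show (0 : ℝ) < 1 / (n + 1) by positivity)
  obtain ⟨τ, hτ⟩ : ∃ τ : ℝ, τ = ∑ k ∈ Finset.range N, lam k := ⟨_, rfl⟩
  have hprodK : ∀ t : ℝ, 0 ≤ t →
      ∏ i ∈ Finset.range N, (1 + t * sNum K (i + 1)) ≤ Real.exp (t * Sk) := by
    intro t ht
    calc _ ≤ ∏ i ∈ Finset.range N, Real.exp (t * sNum K (i + 1)) := by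
          refine Finset.prod_le_prod (fun i _ => by have := sNum_nonneg K (i + 1); positivity)
            fun i _ => ?_
          have := Real.add_one_le_exp (t * sNum K (i + 1))
          linarith
      _ = Real.exp (t * ∑ i ∈ Finset.range N, sNum K (i + 1)) := by
          rw [← Real.exp_sum, Finset.mul_sum]
      _ ≤ _ := by
          rw [Real.exp_le_exp, hSk]
          gcongr
          exact hK.sum_le_tsum _ fun i _ => sNum_nonneg _ _
  have hexpτ : ∀ z : ℂ, ‖Complex.exp (z * τ)‖ = ∏ k ∈ Finset.range N, Real.exp (z * lam k).re := by
    intro z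
    rw [Complex.norm_exp, ← Real.exp_sum, hτ]
    push_cast
    rw [Finset.mul_sum, Complex.re_sum]
  have hPb : ∀ z : ℂ, ‖p z * Complex.exp (z * τ)‖ ≤ Real.exp (G ‖z‖) := by
    intro z
    have h1 := hpd z (fun k => max (1 / 2) ‖1 - z * lam k‖) (1 / 2) (by norm_num)
      (fun k => le_max_left _ _) (fun k => le_max_right _ _)
    have h2 := hprodK (‖z‖ / (1 / 2)) (by positivity)
    have hpos : 0 ≤ ∏ k ∈ Finset.range N, max (1 / 2) ‖1 - z * lam k‖ :=
      Finset.prod_nonneg fun k _ => le_max_of_le_left (by norm_num)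
    rw [norm_mul, hexpτ]
    have hpos2 : 0 ≤ ∏ k ∈ Finset.range N, Real.exp (z * lam k).re :=
      Finset.prod_nonneg fun k _ => (Real.exp_pos _).le
    have h3 : (∏ k ∈ Finset.range N, max (1 / 2) ‖1 - z * lam k‖) *
        ∏ k ∈ Finset.range N, Real.exp (z * lam k).re ≤ Real.exp (3 * (Q * (‖z‖ * √‖z‖))) := by
      rw [← Finset.prod_mul_distrib]
      calc _ ≤ ∏ k ∈ Finset.range N, Real.exp (3 * (‖z * lam k‖ * √‖z * lam k‖)) :=
            Finset.prod_le_prod (fun k _ => mul_nonneg (le_max_of_le_left (by norm_num))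
              (Real.exp_pos _).le) fun k _ => primary_bound _
        _ = Real.exp (3 * ((∑ k ∈ Finset.range N, lam k * √(lam k)) * (‖z‖ * √‖z‖))) := by
            rw [← Real.exp_sum, Finset.sum_mul, Finset.mul_sum]
            congr 1
            refine Finset.sum_congr rfl fun k _ => ?_
            rw [norm_mul, Complex.norm_real, Real.norm_eq_abs, abs_of_nonneg (hlam k),
              Real.sqrt_mul (norm_nonneg _)]
            ring
        _ ≤ _ := by
            rw [Real.exp_le_exp]
            gcongr
            rw [hQ]
            calc _ ≤ ∑ k ∈ Finset.range N, sNum B (k + 1) * √(sNum B (k + 1)) :=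
                  Finset.sum_le_sum fun k _ => mul_le_mul (hlamu k) (Real.sqrt_le_sqrt (hlamu k))
                    (Real.sqrt_nonneg _) (sNum_nonneg _ _)
              _ ≤ _ := hB32.sum_le_tsum _ fun k _ =>
                  mul_nonneg (sNum_nonneg _ _) (Real.sqrt_nonneg _)
    calc _ ≤ ((∏ k ∈ Finset.range N, max (1 / 2) ‖1 - z * lam k‖) *
          Real.exp (‖z‖ / (1 / 2) * Sk)) * ∏ k ∈ Finset.range N, Real.exp (z * lam k).re := by
          refine mul_le_mul_of_nonneg_right (h1.trans ?_) hpos2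
          exact mul_le_mul_of_nonneg_left h2 hpos
      _ = ((∏ k ∈ Finset.range N, max (1 / 2) ‖1 - z * lam k‖) *
          ∏ k ∈ Finset.range N, Real.exp (z * lam k).re) * Real.exp (‖z‖ / (1 / 2) * Sk) := by ring
      _ ≤ Real.exp (3 * (Q * (‖z‖ * √‖z‖))) * Real.exp (‖z‖ / (1 / 2) * Sk) := by gcongr
      _ ≤ _ := by
          rw [← Real.exp_add, Real.exp_le_exp, hG]; dsimp only
          have : ‖z‖ / (1 / 2) = 2 * ‖z‖ := by ring
          rw [this]; linarith
  have hlow := log_ball_bound_two (p := fun z => p z * Complex.exp (z * τ))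
    (hp.mul (by fun_prop)) (by simp [hp0]) hR2 (hG0 R hR0.le) (hG0 2 (by norm_num))
    (fun z hz => mul_ne_zero (hpne z hz) (Complex.exp_ne_zero _))
    (fun z hz => (hPb z).trans (Real.exp_le_exp.2 (hGm _ _ (norm_nonneg _) hz)))
    (fun z hz => (hPb z).trans (Real.exp_le_exp.2 (hGm _ _ (norm_nonneg _) hz)))
    (z := ((-r : ℝ) : ℂ)) (by
      rw [Complex.norm_real, Real.norm_eq_abs, abs_neg, abs_of_pos hr0]; exact hRr)
  have hnr : ‖((-r : ℝ) : ℂ)‖ = r := by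
    rw [Complex.norm_real, Real.norm_eq_abs, abs_neg, abs_of_pos hr0]
  rw [hnr, norm_mul, Complex.norm_exp] at hlow
  have hlam0 : ∀ k, 0 ≤ r * lam k := fun k => mul_nonneg hr0.le (hlam k)
  have hup := hpd ((-r : ℝ) : ℂ) (fun k => 1 + r * lam k) 1 one_pos
    (fun k => by have := hlam0 k; linarith) (fun k => by
      have : (1 : ℂ) - ((-r : ℝ) : ℂ) * lam k = ((1 + r * lam k : ℝ) : ℂ) := by push_cast; ring
      rw [this, Complex.norm_real, Real.norm_eq_abs, abs_of_nonneg]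
      have := hlam0 k; linarith)
  rw [hnr, div_one] at hup
  have hprodpos : ∀ k ∈ Finset.range N, 0 < 1 + r * lam k := fun k _ => by
    have := hlam0 k; linarith
  have hup2 : ‖p ((-r : ℝ) : ℂ)‖ ≤ Real.exp (∑ k ∈ Finset.range N, Real.log (1 + r * lam k) + r * Sk) := by
    rw [Real.exp_add, ← Real.log_prod (fun k hk => (hprodpos k hk).ne'),
      Real.exp_log (Finset.prod_pos hprodpos)]
    exact hup.trans (mul_le_mul_of_nonneg_left (hprodK r hr0.le) (Finset.prod_pos hprodpos).le)
  have hre : (((-r : ℝ) : ℂ) * τ).re = -(r * τ) := by simp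
  rw [hre] at hlow
  have hcomb := hlow.trans (mul_le_mul_of_nonneg_right hup2 (Real.exp_pos _).le)
  rw [← Real.exp_add, Real.exp_le_exp] at hcomb
  have hmain : ∑ k ∈ Finset.range N, (r * lam k - Real.log (1 + r * lam k)) ≤
      r * (2 * G 2 + 1 + Sk) := by
    rw [Finset.sum_sub_distrib, ← Finset.mul_sum, ← hτ]
    have := mul_le_mul_of_nonneg_left hGR hr0.le
    linarith
  have hsub : ∑ k ∈ (Finset.range n).filter (· < N), (r * lam k / 2 - 2) ≤
      r * (2 * G 2 + 1 + Sk) := by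
    refine le_trans ?_ hmain
    calc _ ≤ ∑ k ∈ (Finset.range n).filter (· < N), (r * lam k - Real.log (1 + r * lam k)) := by
          refine Finset.sum_le_sum fun k _ => ?_
          have h0 := hlam0 k
          have h1 := Real.log_le_sub_one_of_pos (show 0 < (1 + r * lam k) / 2 by linarith)
          rw [Real.log_div (by linarith) (by norm_num)] at h1
          have h2 := Real.log_two_lt_d9
          linarith
      _ ≤ _ := by
          refine Finset.sum_le_sum_of_subset_of_nonneg ?_ fun k _ _ => ?_
          · intro k; simp
          · have h0 := hlam0 k
            have h1 := Real.log_le_sub_one_of_pos (show 0 < (1 + r * lam k) by linarith)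
            linarith
  have hbj : ∀ j ∈ Finset.range n, sNum B (j + 1) ≤ (if j < N then lam j else 0) + 1 / (n + 1) := by
    intro j _
    rcases le_or_gt (sNum B (j + 1)) (1 / (n + 1)) with h | h
    · have : 0 ≤ (if j < N then lam j else 0) := by split_ifs; exacts [hlam j, le_rfl]
      linarith
    · obtain ⟨h1, h2⟩ := hlaml j h
      rw [if_pos h1]; linarith
  have hfin := Finset.sum_le_sum hbj
  rw [Finset.sum_add_distrib, ← Finset.sum_filter, Finset.sum_const, Finset.card_range,
    nsmul_eq_mul] at hfin
  rw [Finset.sum_sub_distrib, Finset.sum_const, nsmul_eq_mul, ← Finset.sum_div,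
    ← Finset.mul_sum] at hsub
  have hcard : (((Finset.range n).filter (· < N)).card : ℝ) ≤ n := by
    have := Finset.card_filter_le (Finset.range n) (· < N)
    rw [Finset.card_range] at this
    exact_mod_cast this
  have hn1 : (n : ℝ) * (1 / (n + 1)) ≤ 1 := by
    rw [mul_one_div, div_le_one (by positivity)]; linarith
  obtain ⟨X, hX⟩ : ∃ X, X = ∑ k ∈ (Finset.range n).filter (· < N), lam k := ⟨_, rfl⟩
  rw [← hX] at hfin hsub
  have hX2 : X ≤ 2 * (2 * G 2 + 1 + Sk) + 1 := by
    have h3 : r * X ≤ r * (2 * (2 * G 2 + 1 + Sk) + 1) := by linarith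
    exact le_of_mul_le_mul_left h3 hr0
  linarith
end

open Filter Topology MeasureTheory

section
universe u
variable {H : Type u} [NormedAddCommGroup H] [InnerProductSpace ℂ H]

lemma diag_subspace {E : Type u} [NormedAddCommGroup E] [InnerProductSpace ℂ E]
    [FiniteDimensional ℂ E] {N : ℕ} (b : OrthonormalBasis (Fin N) ℂ E) (w : Fin N → ℝ)
    (hw : Antitone w) (hw0 : ∀ k, 0 ≤ w k) (i : Fin N) :
    ∃ W : Submodule ℂ E, Module.finrank ℂ W = i + 1 ∧
      ∀ v ∈ W, w i * ‖v‖ ≤ ‖diagOp b (fun k => (w k : ℂ)) v‖ := by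
  let f : Fin (i + 1) → E := fun k => b (Fin.castLE (by omega) k)
  have hf : LinearIndependent ℂ f :=
    b.orthonormal.linearIndependent.comp _ (Fin.castLE_injective _)
  refine ⟨Submodule.span ℂ (Set.range f), by rw [finrank_span_eq_card hf]; simp, fun v hv => ?_⟩
  have hz : ∀ k : Fin N, i < k → inner ℂ (b k) v = 0 := by
    intro k hk
    induction hv using Submodule.span_induction with
    | mem x hx =>
      obtain ⟨j, rfl⟩ := hx
      refine b.orthonormal.2 ?_
      intro h
      have h1 : (k : ℕ) = j := by simp [h]
      have := j.2
      have : (i : ℕ) < k := hk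
      omega
    | zero => simp
    | add x y _ _ hx hy => simp [inner_add_right, hx, hy]
    | smul a x _ hx => simp [inner_smul_right, hx]
  refine le_of_sq_le_sq ?_ (by positivity)
  rw [norm_diagOp_sq, mul_pow, ← b.sum_sq_norm_inner_right v, Finset.mul_sum]
  refine Finset.sum_le_sum fun k _ => ?_
  rcases lt_or_ge i k with h | h
  · simp [hz k h]
  · rw [mul_pow]
    have := hw h
    have := hw0 i
    simp only [Complex.norm_real, Real.norm_eq_abs, abs_of_nonneg (hw0 _)]
    gcongr

lemma exists_subspace [CompleteSpace H] {B : H →L[ℂ] H} (hB : B.IsPositive)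
    (hBs : Tendsto (fun n => sNum B n) atTop (𝓝 0)) {n : ℕ} {c : ℝ} (hc : 0 < c)
    (hcn : c < sNum B (n + 1)) :
    ∃ (W : Submodule ℂ H) (_ : FiniteDimensional ℂ W), Module.finrank ℂ W = n + 1 ∧
      ∀ v ∈ W, c * ‖v‖ ≤ ‖B v‖ := by
  obtain ⟨V, hV, h1, -⟩ := exists_approx hBs hBs (sub_pos.2 hcn)
  have h2 := sNum_le_compress V B (n + 1)
  have h3 : c ≤ sNum (compress V B) (n + 1) := by linarith
  have h4 : n < Module.finrank ℂ V := by
    by_contra! h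
    rw [sNum_eq_zero_of_finrank_lt _ (by omega)] at h3
    linarith
  obtain ⟨b, w, hw, hw0, hd⟩ := exists_diag (compress_isPositive V hB) rfl
  obtain ⟨W, hW, hW2⟩ := diag_subspace b w hw hw0 ⟨n, h4⟩
  have h5 := sNum_diagOp_le b w hw hw0 ⟨n, h4⟩
  rw [← hd] at h5 hW2
  refine ⟨W.map V.subtype, inferInstance, ?_, ?_⟩
  · rw [← hW]
    exact (Submodule.equivMapOfInjective V.subtype V.injective_subtype W).finrank_eq.symm
  · rintro _ ⟨v, hv, rfl⟩
    have h6 := hW2 v hv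
    have h7 : ‖compress V B v‖ ≤ ‖B v‖ := by
      have := compress_coe V B v
      change ‖((compress V B v : V) : H)‖ ≤ _
      rw [this]
      exact V.norm_starProjection_apply_le _
    have h8 : c ≤ w ⟨n, h4⟩ := h3.trans h5
    have h9 : c * ‖v‖ ≤ w ⟨n, h4⟩ * ‖v‖ := by gcongr
    exact (h9.trans h6).trans h7

lemma pow_lower [CompleteSpace H] {B : H →L[ℂ] H} (hB : IsSelfAdjoint B) {c : ℝ} (hc : 0 < c)
    {x : H} (hx : c * ‖x‖ ≤ ‖B x‖) (k : ℕ) :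
    c * ‖(B ^ k) x‖ ≤ ‖(B ^ (k + 1)) x‖ := by
  induction k with
  | zero => simpa using hx
  | succ k ih =>
    have hm : ‖(B ^ (k + 1)) x‖ ^ 2 ≤ ‖(B ^ k) x‖ * ‖(B ^ (k + 2)) x‖ := by
      have e : inner ℂ ((B ^ (k + 1)) x) ((B ^ (k + 1)) x) =
          inner ℂ ((B ^ k) x) ((B ^ (k + 2)) x) := by
        have e1 : (B ^ (k + 2)) x = B ((B ^ (k + 1)) x) := by rw [pow_succ' B (k + 1)]; rfl
        have e2 : (B ^ (k + 1)) x = B ((B ^ k) x) := by rw [pow_succ' B k]; rfl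
        rw [e1]
        nth_rewrite 1 [e2]
        nth_rewrite 1 [← ContinuousLinearMap.isSelfAdjoint_iff'.1 hB]
        rw [ContinuousLinearMap.adjoint_inner_left]
      have := norm_inner_le_norm (𝕜 := ℂ) ((B ^ k) x) ((B ^ (k + 2)) x)
      rw [← e, inner_self_eq_norm_sq_to_K] at this
      simpa using this
    rcases (norm_nonneg ((B ^ (k + 1)) x)).eq_or_lt with h | h
    · rw [← h]; simp
    · rcases (norm_nonneg ((B ^ k) x)).eq_or_lt with h0 | h0
      · rw [← h0, zero_mul] at hm; nlinarith
      · have : c * ‖(B ^ (k + 1)) x‖ * ‖(B ^ k) x‖ ≤ ‖(B ^ (k + 2)) x‖ * ‖(B ^ k) x‖ := by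
          nlinarith
        exact le_of_mul_le_mul_right this h0

lemma pow_lower' [CompleteSpace H] {B : H →L[ℂ] H} (hB : IsSelfAdjoint B) {c : ℝ} (hc : 0 < c)
    {x : H} (hx : c * ‖x‖ ≤ ‖B x‖) (k : ℕ) :
    c ^ k * ‖x‖ ≤ ‖(B ^ k) x‖ := by
  induction k with
  | zero => simp
  | succ k ih =>
    calc c ^ (k + 1) * ‖x‖ = c * (c ^ k * ‖x‖) := by ring
      _ ≤ c * ‖(B ^ k) x‖ := by gcongr
      _ ≤ _ := pow_lower hB hc hx k

lemma sNum_pow_ge [CompleteSpace H] {B : H →L[ℂ] H} (hB : B.IsPositive)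
    (hBs : Tendsto (fun n => sNum B n) atTop (𝓝 0)) {n : ℕ} {c : ℝ} (hc : 0 < c)
    (hcn : c < sNum B (n + 1)) (k : ℕ) : c ^ k ≤ sNum (B ^ k) (n + 1) := by
  obtain ⟨W, hW, h1, h2⟩ := exists_subspace hB hBs hc hcn
  exact le_sNum_of_subspace (by omega) W h1.ge fun v hv => pow_lower' hB.isSelfAdjoint hc (h2 v hv) k

lemma isPositive_pow' [CompleteSpace H] {B : H →L[ℂ] H} (hB : B.IsPositive) (k : ℕ) :
    (B ^ k).IsPositive := by
  rw [← ContinuousLinearMap.nonneg_iff_isPositive] at *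
  exact CStarAlgebra.pow_nonneg hB k

lemma half_pow0 {α : ℝ} (hα : 0 ≤ α) (i : ℕ) :
    (((i / 2 : ℕ) : ℝ) + 1) ^ (-α) ≤ 2 ^ α * (i + 1 : ℝ) ^ (-α) := by
  rcases hα.eq_or_lt with rfl | h
  · simp
  · exact half_pow h i

/-- single-index product estimate -/
lemma mul_step {S T : H →L[ℂ] H} {α β M M' : ℝ} (hα : 0 ≤ α) (hβ : 0 ≤ β) (hM : 0 ≤ M) (i : ℕ)
    (hM' : 0 ≤ M')
    (hS : sNum S (i / 2 + 1) ≤ M * ((i / 2 : ℕ) + 1 : ℝ) ^ (-α))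
    (hT : sNum T (i / 2 + 1) ≤ M' * ((i / 2 : ℕ) + 1 : ℝ) ^ (-β)) :
    sNum (S * T) (i + 1) ≤ M * M' * 2 ^ (α + β) * (i + 1 : ℝ) ^ (-(α + β)) := by
  refine (sNum_dec_index _ i).trans ((sNum_mul_le S T _ _).trans ?_)
  calc _ ≤ (M * ((i / 2 : ℕ) + 1 : ℝ) ^ (-α)) * (M' * ((i / 2 : ℕ) + 1 : ℝ) ^ (-β)) :=
        mul_le_mul hS hT (sNum_nonneg _ _) (by positivity)
    _ = M * M' * ((i / 2 : ℕ) + 1 : ℝ) ^ (-(α + β)) := by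
        rw [neg_add, Real.rpow_add (by positivity)]; ring
    _ ≤ M * M' * (2 ^ (α + β) * (i + 1 : ℝ) ^ (-(α + β))) := by
        gcongr; exact half_pow0 (by positivity) i
    _ = _ := by ring

lemma tendsto_half : Tendsto (fun i : ℕ => i / 2) atTop atTop :=
  Nat.tendsto_div_const_atTop (by norm_num)

lemma little_mul {S T : H →L[ℂ] H} {α β M : ℝ} (hα : 0 ≤ α) (hβ : 0 ≤ β) (hM : 0 ≤ M)
    (hS : ∀ ε : ℝ, 0 < ε → ∀ᶠ j : ℕ in atTop, sNum S (j + 1) ≤ ε * (j + 1 : ℝ) ^ (-α))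
    (hT : ∀ j : ℕ, sNum T (j + 1) ≤ M * (j + 1 : ℝ) ^ (-β)) :
    ∀ ε : ℝ, 0 < ε → ∀ᶠ j : ℕ in atTop, sNum (S * T) (j + 1) ≤ ε * (j + 1 : ℝ) ^ (-(α + β)) := by
  intro ε hε
  have hD : 0 < (M + 1) * 2 ^ (α + β) := by positivity
  filter_upwards [tendsto_half.eventually (hS (ε / ((M + 1) * 2 ^ (α + β))) (by positivity))] with i hi
  refine (mul_step hα hβ (by positivity) i (M' := M + 1) (by positivity) hi
    ((hT _).trans (by gcongr; linarith))).trans (le_of_eq ?_)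
  field_simp

lemma mul_little {S T : H →L[ℂ] H} {α β M : ℝ} (hα : 0 ≤ α) (hβ : 0 ≤ β) (hM : 0 ≤ M)
    (hS : ∀ j : ℕ, sNum S (j + 1) ≤ M * (j + 1 : ℝ) ^ (-α))
    (hT : ∀ ε : ℝ, 0 < ε → ∀ᶠ j : ℕ in atTop, sNum T (j + 1) ≤ ε * (j + 1 : ℝ) ^ (-β)) :
    ∀ ε : ℝ, 0 < ε → ∀ᶠ j : ℕ in atTop, sNum (S * T) (j + 1) ≤ ε * (j + 1 : ℝ) ^ (-(α + β)) := by
  intro ε hε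
  have hD : 0 < (M + 1) * 2 ^ (α + β) := by positivity
  filter_upwards [tendsto_half.eventually (hT (ε / ((M + 1) * 2 ^ (α + β))) (by positivity))] with i hi
  refine (mul_step (M := M + 1) hα hβ (by positivity) i (by positivity)
    ((hS _).trans (by gcongr; linarith)) hi).trans (le_of_eq ?_)
  field_simp

lemma little_add {S T : H →L[ℂ] H} {α : ℝ} (hα : 0 ≤ α)
    (hS : ∀ ε : ℝ, 0 < ε → ∀ᶠ j : ℕ in atTop, sNum S (j + 1) ≤ ε * (j + 1 : ℝ) ^ (-α))
    (hT : ∀ ε : ℝ, 0 < ε → ∀ᶠ j : ℕ in atTop, sNum T (j + 1) ≤ ε * (j + 1 : ℝ) ^ (-α)) :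
    ∀ ε : ℝ, 0 < ε → ∀ᶠ j : ℕ in atTop, sNum (S + T) (j + 1) ≤ ε * (j + 1 : ℝ) ^ (-α) := by
  intro ε hε
  have hD : 0 < (2 : ℝ) * 2 ^ α := by positivity
  filter_upwards [tendsto_half.eventually (hT (ε / (2 * 2 ^ α)) (by positivity)),
    tendsto_half.eventually (hS (ε / (2 * 2 ^ α)) (by positivity))] with i h1 h2
  refine (sNum_dec_index _ i).trans ((sNum_add_le S T _ _).trans ?_)
  have h3 := half_pow0 hα i
  calc _ ≤ _ := add_le_add h2 h1
    _ = ε / 2 ^ α * ((i / 2 : ℕ) + 1 : ℝ) ^ (-α) := by field_simp; ring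
    _ ≤ ε / 2 ^ α * (2 ^ α * (i + 1 : ℝ) ^ (-α)) := by gcongr
    _ = _ := by field_simp

lemma pow_bound {B : H →L[ℂ] H} {α M : ℝ} (hα : 0 < α) (hM : 0 ≤ M)
    (hB : ∀ j : ℕ, sNum B (j + 1) ≤ M * (j + 1 : ℝ) ^ (-α)) (k : ℕ) :
    ∃ M' : ℝ, 0 ≤ M' ∧ ∀ j : ℕ, sNum (B ^ k) (j + 1) ≤ M' * (j + 1 : ℝ) ^ (-(k * α)) := by
  induction k with
  | zero =>
    refine ⟨‖(1 : H →L[ℂ] H)‖, norm_nonneg _, fun j => ?_⟩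
    simpa using sNum_le_norm (1 : H →L[ℂ] H) (n := j + 1) (by omega)
  | succ k ih =>
    obtain ⟨M', h0, h⟩ := ih
    refine ⟨M' * M * 2 ^ (k * α + α), by positivity, fun j => ?_⟩
    have := mul_step (S := B ^ k) (T := B) (by positivity) hα.le h0 j hM (h _) (hB _)
    rw [pow_succ]
    have e : ((k + 1 : ℕ) : ℝ) * α = k * α + α := by push_cast; ring
    rw [e]; exact this

lemma pow_little {B T : H →L[ℂ] H} {α M M' : ℝ} (hα : 0 < α) (hM : 0 ≤ M) (hM' : 0 ≤ M')
    (hB : ∀ j : ℕ, sNum B (j + 1) ≤ M * (j + 1 : ℝ) ^ (-α))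
    (hT : ∀ j : ℕ, sNum T (j + 1) ≤ M' * (j + 1 : ℝ) ^ (-α))
    (hK : ∀ ε : ℝ, 0 < ε → ∀ᶠ j : ℕ in atTop, sNum (T - B) (j + 1) ≤ ε * (j + 1 : ℝ) ^ (-α)) (k : ℕ) :
    ∀ ε : ℝ, 0 < ε → ∀ᶠ j : ℕ in atTop,
      sNum (T ^ k - B ^ k) (j + 1) ≤ ε * (j + 1 : ℝ) ^ (-(k * α)) := by
  induction k with
  | zero =>
    intro ε hε
    refine Eventually.of_forall fun j => ?_
    have := sNum_le_norm (0 : H →L[ℂ] H) (n := j + 1) (by omega)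
    simp at this ⊢
    linarith
  | succ k ih =>
    obtain ⟨C, hC, hBk⟩ := pow_bound hα hM hB k
    have e : ((k + 1 : ℕ) : ℝ) * α = k * α + α := by push_cast; ring
    have e2 : T ^ (k + 1) - B ^ (k + 1) = (T ^ k - B ^ k) * T + B ^ k * (T - B) := by
      rw [pow_succ, pow_succ]; noncomm_ring
    rw [e, e2]
    exact little_add (by positivity) (little_mul (by positivity) hα.le hM' ih hT)
      (mul_little (by positivity) hα.le hC hBk hK)

lemma isUnit_pow_aux {T : H →L[ℂ] H} (hA : ∀ z : ℂ, IsUnit (1 - z • T)) {k : ℕ} (hk : 0 < k)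
    (z : ℂ) : IsUnit (1 - z • T ^ k) := by
  rcases eq_or_ne z 0 with rfl | hz
  · simp
  have h := spectrum.map_pow_of_pos (𝕜 := ℂ) T hk
  have hs : spectrum ℂ T ⊆ {0} := by
    intro μ hμ
    by_contra h0
    have h0 : μ ≠ 0 := h0
    refine hμ ?_
    have e : algebraMap ℂ (H →L[ℂ] H) μ - T = μ • (1 - μ⁻¹ • T) := by
      rw [smul_sub, smul_smul, mul_inv_cancel₀ h0, one_smul, Algebra.algebraMap_eq_smul_one]
    rw [spectrum.mem_resolventSet_iff, e]
    exact (hA _).smul (Units.mk0 μ h0)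
  have h1 : z⁻¹ ∉ spectrum ℂ (T ^ k) := by
    rw [h]
    rintro ⟨μ, hμ, h2⟩
    rw [hs hμ] at h2
    simp [hk.ne'] at h2
    exact hz h2.symm
  rw [spectrum.notMem_iff] at h1
  have e : 1 - z • T ^ k = z • (algebraMap ℂ (H →L[ℂ] H) z⁻¹ - T ^ k) := by
    rw [smul_sub, Algebra.algebraMap_eq_smul_one, smul_smul, mul_inv_cancel₀ hz, one_smul]
  rw [e]
  exact h1.smul (Units.mk0 z hz)
end

open Filter Topology MeasureTheory

lemma antitone_summable_little {f : ℕ → ℝ} (hf : Antitone f) (hs : Summable f)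
    {δ : ℝ} (hδ : 0 < δ) : ∀ᶠ j : ℕ in atTop, f j ≤ δ * (j + 1 : ℝ)⁻¹ := by
  have h1 := hs.tendsto_sum_tsum_nat
  have h2 := ((tendsto_add_atTop_iff_nat 1).2 h1).sub (h1.comp tendsto_half)
  rw [sub_self] at h2
  filter_upwards [h2.eventually (gt_mem_nhds (half_pos hδ))] with j hj
  simp only [Function.comp_apply] at hj
  rw [← Finset.sum_Ico_eq_sub _ (by omega : j / 2 ≤ j + 1)] at hj
  have h3 : ∑ i ∈ Finset.Ico (j / 2) (j + 1), f j ≤ ∑ i ∈ Finset.Ico (j / 2) (j + 1), f i :=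
    Finset.sum_le_sum fun i hi => hf (by simp at hi; omega)
  rw [Finset.sum_const, Nat.card_Ico, nsmul_eq_mul] at h3
  have h4 : (j + 1 : ℝ) ≤ 2 * ((j + 1 - j / 2 : ℕ) : ℝ) := by
    have : j + 1 ≤ 2 * (j + 1 - j / 2) := by omega
    exact_mod_cast this
  rw [← div_eq_mul_inv, le_div_iff₀ (by positivity)]
  rcases le_total 0 (f j) with h | h
  · nlinarith
  · have : f j * (j + 1 : ℝ) ≤ 0 := mul_nonpos_of_nonpos_of_nonneg h (by positivity)
    linarith

section
universe u
variable {H : Type u} [NormedAddCommGroup H] [InnerProductSpace ℂ H]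

lemma little_of_summable {K : H →L[ℂ] H} {α q : ℝ} (hα : 0 < α) (hq0 : 0 < q) (hqα : q ≤ 1 / α)
    (hKq : Summable (fun n : ℕ => sNum K (n + 1) ^ q)) :
    ∀ ε : ℝ, 0 < ε → ∀ᶠ j : ℕ in atTop, sNum K (j + 1) ≤ ε * (j + 1 : ℝ) ^ (-α) := by
  intro ε hε
  have hanti : Antitone (fun n : ℕ => sNum K (n + 1) ^ q) := fun m n h =>
    Real.rpow_le_rpow (sNum_nonneg _ _) (sNum_anti K (by omega) (by omega)) hq0.le
  filter_upwards [antitone_summable_little hanti hKq (show 0 < ε ^ q by positivity)] with j hj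
  have h1 : sNum K (j + 1) ≤ ε * (j + 1 : ℝ) ^ (-(1 / q)) := by
    have h2 := Real.rpow_le_rpow (by have := sNum_nonneg K (j + 1); positivity) hj
      (show 0 ≤ 1 / q by positivity)
    rw [← Real.rpow_mul (sNum_nonneg _ _), mul_one_div_cancel hq0.ne', Real.rpow_one,
      Real.mul_rpow (by positivity) (by positivity), ← Real.rpow_mul hε.le,
      mul_one_div_cancel hq0.ne', Real.rpow_one, ← Real.rpow_neg_one,
      ← Real.rpow_mul (by positivity), neg_one_mul] at h2
    exact h2
  refine h1.trans ?_
  gcongr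
  · linarith [show (0:ℝ) ≤ j by positivity]
  · rw [le_div_iff₀ hα] at hqα
    rw [le_div_iff₀ hq0]; linarith

lemma isCompact_of_tendsto [CompleteSpace H] {T : H →L[ℂ] H}
    (hT : Tendsto (fun n => sNum T n) atTop (𝓝 0)) : IsCompactOperator (T : H → H) := by
  choose F n hF hF2 using fun i : ℕ => exists_finrank_approx hT (show 0 < 1 / ((i : ℝ) + 1) by positivity)
  have hlim : Tendsto F atTop (𝓝 T) := by
    rw [tendsto_iff_norm_sub_tendsto_zero]
    refine squeeze_zero (fun _ => norm_nonneg _) (fun i => ?_) tendsto_one_div_add_atTop_nhds_zero_nat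
    rw [norm_sub_rev]; exact (hF2 i).le
  refine isCompactOperator_of_tendsto hlim (Eventually.of_forall fun i => ?_)
  have := finiteDimensional_range_of_rank_lt (hF i)
  set W := LinearMap.range (F i : H →ₗ[ℂ] H)
  have : ProperSpace W := FiniteDimensional.proper ℂ W
  let G : H →L[ℂ] W := (F i).codRestrict W (fun x => ⟨x, rfl⟩)
  have hG : IsCompactOperator (G : H → W) := (isCompactOperator_id (E := W)).comp_clm G
  exact hG.clm_comp W.subtypeL

theorem pow_contra [CompleteSpace H] {B K : H →L[ℂ] H} (hB : B.IsPositive) {α M c : ℝ} (h0 : 0 < α)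
    (h1 : α < 1) (hM : 0 < M) (hc : 0 < c)
    (hBu : ∀ j : ℕ, sNum B (j + 1) ≤ M * (j + 1 : ℝ) ^ (-α))
    (hBl : ∀ᶠ j : ℕ in atTop, c * (j + 1 : ℝ) ^ (-α) ≤ sNum B (j + 1))
    (hK : ∀ ε : ℝ, 0 < ε → ∀ᶠ j : ℕ in atTop, sNum K (j + 1) ≤ ε * (j + 1 : ℝ) ^ (-α))
    (hA : ∀ z : ℂ, IsUnit (1 - z • (B + K))) : False := by
  obtain ⟨MK, hMK, hKu⟩ := bdd_of_little hK
  have hT := dec_add h0 hBu hKu hM.le hMK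
  set k := ⌊1 / α⌋₊ + 1 with hk
  have hk1 : 1 < (k : ℝ) * α := by
    have := Nat.lt_floor_add_one (1 / α)
    rw [div_lt_iff₀ h0] at this
    rw [hk]; push_cast; exact this
  have hk2 : (k : ℝ) * α < 2 := by
    have := Nat.floor_le (show 0 ≤ 1 / α by positivity)
    rw [le_div_iff₀ h0] at this
    rw [hk]; push_cast; linarith
  obtain ⟨M', hM', hBk⟩ := pow_bound h0 hM.le hBu k
  have hBs := tendsto_of_dec h0 hBu
  refine core_contra (B := B ^ k) (K := (B + K) ^ k - B ^ k) (M := M' + 1) (c := (c / 2) ^ k)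
    (isPositive_pow' hB k) hk1 hk2 (by positivity) (by positivity) ?_ ?_ ?_ ?_
  · intro j
    refine (hBk j).trans ?_
    gcongr; linarith
  · filter_upwards [hBl] with j hj
    have hp : 0 < (j + 1 : ℝ) ^ (-α) := by positivity
    have h2 := sNum_pow_ge hB hBs (c := c / 2 * (j + 1 : ℝ) ^ (-α)) (by positivity)
      (lt_of_lt_of_le (by nlinarith) hj) k
    refine le_trans (le_of_eq ?_) h2
    rw [mul_pow, ← Real.rpow_mul_natCast (by positivity)]
    congr 2; ring
  · exact pow_little h0 hM.le (by positivity) hBu hT (by simpa using hK) k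
  · intro z
    rw [add_sub_cancel]
    exact isUnit_pow_aux hA (by omega) z

theorem main_abs [CompleteSpace H] {B K : H →L[ℂ] H}
    (hBpos : B.IsPositive)
    (α a q : ℝ) (hα0 : 0 < α) (hα2 : α < 2) (ha0 : 0 < a)
    (hBα : Tendsto (fun n : ℕ => (n : ℝ) ^ α * sNum B n) atTop (𝓝 a))
    (hq0 : 0 < q) (hqα : q ≤ 1 / α)
    (hKq : Summable (fun n : ℕ => sNum K (n + 1) ^ q)) :
    ∃ μ : ℂ, μ ≠ 0 ∧
      Module.End.HasEigenvalue ((ContinuousLinearMap.adjoint (B + K : H →L[ℂ] H)) : H →ₗ[ℂ] H) μ := by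
  by_contra! hne
  set K' := ContinuousLinearMap.adjoint K with hK'
  have hadj : ContinuousLinearMap.adjoint (B + K : H →L[ℂ] H) = B + K' := by
    rw [map_add, ContinuousLinearMap.isSelfAdjoint_iff'.1 hBpos.isSelfAdjoint]
  rw [hadj] at hne
  have hKl := little_of_summable hα0 hq0 hqα hKq
  have hK'l : ∀ ε : ℝ, 0 < ε → ∀ᶠ j : ℕ in atTop, sNum K' (j + 1) ≤ ε * (j + 1 : ℝ) ^ (-α) :=
    fun ε hε => (hKl ε hε).mono fun j hj => (sNum_adjoint_le K _).trans hj
  have hB1 : Tendsto (fun j : ℕ => (j + 1 : ℝ) ^ α * sNum B (j + 1)) atTop (𝓝 a) := by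
    have := (tendsto_add_atTop_iff_nat 1).2 hBα
    simpa using this
  have hinv : ∀ j : ℕ, (j + 1 : ℝ) ^ α * (j + 1 : ℝ) ^ (-α) = 1 := fun j => by
    rw [← Real.rpow_add (by positivity)]; simp
  obtain ⟨M0, hM0⟩ := hB1.bddAbove_range
  have hBu : ∀ j : ℕ, sNum B (j + 1) ≤ (|M0| + 1) * (j + 1 : ℝ) ^ (-α) := by
    intro j
    have h1 : (j + 1 : ℝ) ^ α * sNum B (j + 1) ≤ |M0| + 1 :=
      (hM0 ⟨j, rfl⟩).trans ((le_abs_self _).trans (by linarith))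
    have hp : 0 < (j + 1 : ℝ) ^ (-α) := by positivity
    calc sNum B (j + 1) = ((j + 1 : ℝ) ^ α * (j + 1 : ℝ) ^ (-α)) * sNum B (j + 1) := by
          rw [hinv, one_mul]
      _ = ((j + 1 : ℝ) ^ α * sNum B (j + 1)) * (j + 1 : ℝ) ^ (-α) := by ring
      _ ≤ _ := by gcongr
  have hM : 0 < |M0| + 1 := by positivity
  have hBl : ∀ᶠ j : ℕ in atTop, a / 2 * (j + 1 : ℝ) ^ (-α) ≤ sNum B (j + 1) := by
    filter_upwards [hB1.eventually (lt_mem_nhds (half_lt_self ha0))] with j hj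
    have hp : 0 < (j + 1 : ℝ) ^ (-α) := by positivity
    calc a / 2 * (j + 1 : ℝ) ^ (-α) ≤ ((j + 1 : ℝ) ^ α * sNum B (j + 1)) * (j + 1 : ℝ) ^ (-α) := by gcongr
      _ = ((j + 1 : ℝ) ^ α * (j + 1 : ℝ) ^ (-α)) * sNum B (j + 1) := by ring
      _ = _ := by rw [hinv, one_mul]
  obtain ⟨MK, hMK, hKu⟩ := bdd_of_little hK'l
  have hTs := tendsto_of_dec hα0 (dec_add hα0 hBu hKu hM.le hMK)
  have hcomp := isCompact_of_tendsto hTs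
  have hA : ∀ z : ℂ, IsUnit (1 - z • (B + K')) := by
    intro z
    rcases eq_or_ne z 0 with rfl | hz
    · simp
    have h1 := (hcomp.hasEigenvalue_or_mem_resolventSet (inv_ne_zero hz)).resolve_left
      (hne _ (inv_ne_zero hz))
    rw [spectrum.mem_resolventSet_iff] at h1
    have e : 1 - z • (B + K') = z • (algebraMap ℂ (H →L[ℂ] H) z⁻¹ - (B + K')) := by
      rw [smul_sub, Algebra.algebraMap_eq_smul_one, smul_smul, mul_inv_cancel₀ hz, one_smul]
    rw [e]
    exact h1.smul (Units.mk0 z hz)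
  rcases lt_trichotomy α 1 with h | h | h
  · exact pow_contra hBpos hα0 h hM (half_pos ha0) hBu hBl hK'l hA
  · subst h
    have hq1 : q ≤ 1 := by simpa using hqα
    refine one_contra hBpos (tendsto_of_dec hα0 hBu) hTs ?_ ?_ ?_ hA
    · have hsum : Summable fun j : ℕ => (|M0| + 1) * √(|M0| + 1) * (j + 1 : ℝ) ^ (-(3 / 2 : ℝ)) := by
        refine Summable.mul_left _ ?_
        have := (summable_nat_add_iff 1).2 (Real.summable_nat_rpow.2 (show -(3 / 2 : ℝ) < -1 by norm_num))
        simpa using this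
      refine Summable.of_nonneg_of_le (fun j => mul_nonneg (sNum_nonneg _ _) (Real.sqrt_nonneg _))
        (fun j => ?_) hsum
      calc _ ≤ ((|M0| + 1) * (j + 1 : ℝ) ^ (-1 : ℝ)) * √((|M0| + 1) * (j + 1 : ℝ) ^ (-1 : ℝ)) := by
            gcongr
            · exact hBu j
            · exact hBu j
        _ = _ := by
            rw [Real.sqrt_mul hM.le, Real.sqrt_eq_rpow ((j + 1 : ℝ) ^ (-1 : ℝ)),
              ← Real.rpow_mul (by positivity)]
            have : (j + 1 : ℝ) ^ (-(3 / 2 : ℝ)) =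
                (j + 1 : ℝ) ^ (-1 : ℝ) * (j + 1 : ℝ) ^ (-1 * (1 / 2) : ℝ) := by
              rw [← Real.rpow_add (by positivity)]; norm_num
            rw [this]; ring
    · intro hs
      have h2 : Summable fun j : ℕ => a / 2 * (j + 1 : ℝ) ^ (-1 : ℝ) := by
        refine summable_of_isBigO_nat hs ?_
        refine Asymptotics.IsBigO.of_bound 1 ?_
        filter_upwards [hBl] with j hj
        rw [Real.norm_of_nonneg (by positivity), Real.norm_of_nonneg (sNum_nonneg _ _), one_mul]
        exact hj
      have h3 := (summable_mul_left_iff (half_pos ha0).ne').1 h2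
      have h4 : Summable fun j : ℕ => (j : ℝ) ^ (-1 : ℝ) := by
        rw [← summable_nat_add_iff 1]; simpa using h3
      rw [Real.summable_nat_rpow] at h4
      linarith
    · refine summable_of_isBigO_nat hKq ?_
      refine Asymptotics.IsBigO.of_bound 1 ?_
      have hKs := tendsto_of_dec hα0 (bdd_of_little hKl).choose_spec.2
      have hKs1 := (tendsto_add_atTop_iff_nat 1).2 hKs
      filter_upwards [hKs1.eventually (gt_mem_nhds one_pos)] with j hj
      have hn := sNum_nonneg K (j + 1)
      rw [Real.norm_of_nonneg (sNum_nonneg _ _), Real.norm_of_nonneg (by positivity), one_mul]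
      refine (sNum_adjoint_le K _).trans ?_
      exact Real.self_le_rpow_of_le_one hn hj.le hq1
  · exact core_contra hBpos h hα2 hM (half_pos ha0) hBu hBl hK'l hA
end

/-- **Theorem 3.1.** Let `Ω ⊂ ℝ^m` be a bounded domain with infinitely smooth boundary,
let `B` be a non-negative injective compact operator on `L²(Ω)` inverting `-Δ` in the
distributional sense, with `n ^ 2 * s n (B) → ∞` and `n ^ α * s n (B) → a` for some
`0 < α < 2`, `0 < a < ∞`, and let `K ∈ S_q` (`0 < q ≤ 1/α`) have range consisting of
harmonic functions.  Then the adjoint `(B + K)^* = B + K^*` has a nonzero eigenvalue, i.e. the adjoint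
`L_K^*` of the corresponding well-defined restriction `L_K` is not Volterra. -/
theorem statement6 {m : ℕ} (Ω : Set (EuclideanSpace ℝ (Fin m)))
    (hΩopen : IsOpen Ω) (hΩconn : IsConnected Ω) (hΩbdd : Bornology.IsBounded Ω)
    (hΩsmooth : HasSmoothBoundary Ω)
    (B K : Lp ℂ 2 (volume.restrict Ω) →L[ℂ] Lp ℂ 2 (volume.restrict Ω))
    (hBpos : B.IsPositive) (hBinj : Function.Injective ⇑B)
    (hBcompact : IsCompactOperator (⇑B))
    (hBinv : ∀ f : Lp ℂ 2 (volume.restrict Ω), WeakNegLapEq Ω (⇑(B f)) (⇑f))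
    (α a q : ℝ) (hα0 : 0 < α) (hα2 : α < 2) (ha0 : 0 < a)
    (hB2 : Tendsto (fun n : ℕ => (n : ℝ) ^ 2 * sNum B n) atTop atTop)
    (hBα : Tendsto (fun n : ℕ => (n : ℝ) ^ α * sNum B n) atTop (𝓝 a))
    (hq0 : 0 < q) (hqα : q ≤ 1 / α)
    (hKq : Summable (fun n : ℕ => sNum K (n + 1) ^ q))
    (hKharm : ∀ f : Lp ℂ 2 (volume.restrict Ω), WeakHarmonicOn Ω (⇑(K f))) :
    ∃ μ : ℂ, μ ≠ 0 ∧
      Module.End.HasEigenvalue ((ContinuousLinearMap.adjoint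
        (B + K : Lp ℂ 2 (volume.restrict Ω) →L[ℂ] Lp ℂ 2 (volume.restrict Ω))) :
        Lp ℂ 2 (volume.restrict Ω) →ₗ[ℂ] Lp ℂ 2 (volume.restrict Ω)) μ := by

  exact main_abs hBpos α a q hα0 hα2 ha0 hBα hq0 hqα hKq
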